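/- Let T be a compactly generated R-linear triangulated category that is noetherian and stratified by R. For any objects X and Y of T the following conditions are equivalent: (1) Hom*_T(X,Y') = 0 for every Y' in Loc_T(Y); (2) cl(supp_R X) ∩ supp_R Y = ∅, where cl(U) = {p ∈ Spec R | there exists q ∈ U with q ⊆ p} is the specialization closure of a subset U of Spec R. -/

import Mathlib

open CategoryTheory CategoryTheory.Limits CategoryTheory.Pretriangulated

universe w v u u'

namespace BIK

section RingDefs

variable {R : Type u} [Ring R] (𝒜 : ℤ → AddSubgroup R) [GradedRing 𝒜]

/-- `R` is graded-commutative: `a * b = (-1)^{|a||b|} b * a` for homogeneous `a`, `b`. -/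
def IsGradedComm : Prop :=
  ∀ (i j : ℤ) (a b : R), a ∈ 𝒜 i → b ∈ 𝒜 j →
    a * b = ((-1 : ℤ) ^ (i * j).natAbs) • (b * a)

/-- A homogeneous ideal is prime if it is proper and for homogeneous elements `a`, `b`,
`a * b ∈ P` implies `a ∈ P` or `b ∈ P`. -/
structure IsHomPrime (P : HomogeneousIdeal 𝒜) : Prop where
  ne_top : P.toIdeal ≠ ⊤
  mem_or_mem : ∀ {i j : ℤ} {a b : R}, a ∈ 𝒜 i → b ∈ 𝒜 j →
    a * b ∈ P.toIdeal → a ∈ P.toIdeal ∨ b ∈ P.toIdeal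

/-- `Spec R`: the set of homogeneous prime ideals of the graded ring `R`. -/
def SpecR : Type u := {P : HomogeneousIdeal 𝒜 // IsHomPrime 𝒜 P}

variable {𝒜}

/-- `V(𝔞)`, the set of homogeneous primes containing the ideal `𝔞`. -/
def specV (𝔞 : Ideal R) : Set (SpecR 𝒜) := {p | 𝔞 ≤ p.1.toIdeal}

/-- A subset of `Spec R` is specialization closed if with any point it contains all larger
primes. -/
def SpecClosed (V : Set (SpecR 𝒜)) : Prop :=
  ∀ p q : SpecR 𝒜, p ∈ V → p.1.toIdeal ≤ q.1.toIdeal → q ∈ V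

/-- `Z(p) = { q | q ⊄ p }`. -/
def Zset (p : SpecR 𝒜) : Set (SpecR 𝒜) := {q | ¬ q.1.toIdeal ≤ p.1.toIdeal}

/-- `V(p) = { q | q ⊇ p }`. -/
def Vp (p : SpecR 𝒜) : Set (SpecR 𝒜) := {q | p.1.toIdeal ≤ q.1.toIdeal}

/-- The specialization closure of a subset of `Spec R`. -/
def specCl (U : Set (SpecR 𝒜)) : Set (SpecR 𝒜) := {p | ∃ q ∈ U, q.1.toIdeal ≤ p.1.toIdeal}

/-- The subset `U ⊆ Spec R` has finite dimension: the lengths of strict chains of primes in `U`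
are bounded. -/
def FiniteDim (U : Set (SpecR 𝒜)) : Prop :=
  ∃ n : ℕ, ∀ (m : ℕ) (c : Fin (m + 1) → SpecR 𝒜), (∀ i, c i ∈ U) →
    (StrictMono fun i => (c i).1.toIdeal) → m ≤ n

end RingDefs

section CatDefs

variable (T : Type u') [Category.{v} T] [HasZeroObject T] [Preadditive T] [HasShift T ℤ]
  [∀ n : ℤ, (CategoryTheory.shiftFunctor T n).Additive] [Pretriangulated T]
  [HasCoproducts.{v} T]

/-- The canonical map `⨁ⱼ Hom(C, fⱼ) → Hom(C, ∐ f)`. -/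
noncomputable def sigmaHom (C : T) {J : Type v} (f : J → T) :
    (DirectSum J fun j => (C ⟶ f j)) →+ (C ⟶ ∐ f) :=
  letI := Classical.decEq J
  DirectSum.toAddMonoid fun j =>
    AddMonoidHom.mk' (fun g => g ≫ Sigma.ι f j) (fun g h => by simp)

/-- An object `C` is compact if `Hom(C, -)` commutes with arbitrary coproducts. -/
def IsCompactObj (C : T) : Prop :=
  ∀ (J : Type v) (f : J → T), Function.Bijective (sigmaHom T C f)

/-- A localizing subcategory: a (strictly full) triangulated subcategory closed under
arbitrary coproducts. -/
structure IsLocalizing (S : Set T) : Prop where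
  zero_mem : ∀ X : T, Limits.IsZero X → X ∈ S
  iso_mem : ∀ {X Y : T}, (X ≅ Y) → X ∈ S → Y ∈ S
  shift_mem : ∀ X ∈ S, ∀ n : ℤ, X⟦n⟧ ∈ S
  ext_mem : ∀ Tr ∈ distTriang T, Tr.obj₁ ∈ S → Tr.obj₂ ∈ S → Tr.obj₃ ∈ S
  coprod_mem : ∀ (J : Type v) (f : J → T), (∀ j, f j ∈ S) → (∐ f) ∈ S

/-- The localizing subcategory generated by a class of objects. -/
def Loc (A : Set T) : Set T := ⋂₀ {S | IsLocalizing T S ∧ A ⊆ S}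

/-- A thick subcategory: a (strictly full) triangulated subcategory closed under
direct summands (i.e. retracts). -/
structure IsThick (S : Set T) : Prop where
  zero_mem : ∀ X : T, Limits.IsZero X → X ∈ S
  iso_mem : ∀ {X Y : T}, (X ≅ Y) → X ∈ S → Y ∈ S
  shift_mem : ∀ X ∈ S, ∀ n : ℤ, X⟦n⟧ ∈ S
  ext_mem : ∀ Tr ∈ distTriang T, Tr.obj₁ ∈ S → Tr.obj₂ ∈ S → Tr.obj₃ ∈ S
  retract_mem : ∀ X Y : T, Y ∈ S → ∀ (i : X ⟶ Y) (p : Y ⟶ X), i ≫ p = 𝟙 X → X ∈ S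

/-- The thick subcategory generated by a class of objects. -/
def ThickSub (A : Set T) : Set T := ⋂₀ {S | IsThick T S ∧ A ⊆ S}

/-- `T` is compactly generated: it is generated, as a localizing subcategory,
by a set of compact objects. -/
def CompactlyGen : Prop :=
  ∃ (ι : Type v) (g : ι → T), (∀ i, IsCompactObj T (g i)) ∧ Loc T (Set.range g) = Set.univ

end CatDefs

section Action

variable {R : Type u} [Ring R] (𝒜 : ℤ → AddSubgroup R) [GradedRing 𝒜]
variable (T : Type u') [Category.{v} T] [HasZeroObject T] [Preadditive T] [HasShift T ℤ]
  [∀ n : ℤ, (CategoryTheory.shiftFunctor T n).Additive] [Pretriangulated T]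
  [HasCoproducts.{v} T]

/-- An action of the graded ring `R` on the triangulated category `T`, i.e. a homomorphism of
graded rings from `R` to the graded center of `T`: each homogeneous `a ∈ R` of degree `i`
determines a natural transformation `Id → Σⁱ` commuting with the shift up to the sign
`(-1)^i`. -/
structure CenterAction where
  act : ∀ (i : ℤ) (a : R), a ∈ 𝒜 i → ∀ X : T, X ⟶ X⟦i⟧
  act_add : ∀ (i : ℤ) (a b : R) (ha : a ∈ 𝒜 i) (hb : b ∈ 𝒜 i) (X : T),
    act i (a + b) (add_mem ha hb) X = act i a ha X + act i b hb X
  act_one : ∀ X : T, act 0 1 (SetLike.one_mem_graded 𝒜) X = (shiftFunctorZero T ℤ).inv.app X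
  act_mul : ∀ (i j : ℤ) (a b : R) (ha : a ∈ 𝒜 i) (hb : b ∈ 𝒜 j) (X : T),
    act (i + j) (a * b) (SetLike.mul_mem_graded ha hb) X
      = act j b hb X ≫ act i a ha (X⟦j⟧) ≫ (shiftFunctorAdd' T j i (i + j) (by ring)).inv.app X
  act_natural : ∀ (i : ℤ) (a : R) (ha : a ∈ 𝒜 i) {X Y : T} (f : X ⟶ Y),
    f ≫ act i a ha Y = act i a ha X ≫ f⟦i⟧'
  act_shift : ∀ (i : ℤ) (a : R) (ha : a ∈ 𝒜 i) (X : T) (n : ℤ),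
    act i a ha (X⟦n⟧)
      = ((-1 : ℤ) ^ (i * n).natAbs) • ((act i a ha X)⟦n⟧' ≫ (shiftComm X i n).hom)

variable {𝒜 T}

/-- The action of a homogeneous element of `R` on the graded abelian group
`Hom*(X, Y) = ⊕ₙ Hom(X, Y⟦n⟧)`. -/
def CenterAction.hsmul (A : CenterAction 𝒜 T) {i : ℤ} {a : R} (ha : a ∈ 𝒜 i) {X Y : T} {n : ℤ}
    (f : X ⟶ Y⟦n⟧) : X ⟶ Y⟦n + i⟧ :=
  f ≫ A.act i a ha (Y⟦n⟧) ≫ (shiftFunctorAdd' T n i (n + i) rfl).inv.app Y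

/-- The homogeneous localization of the graded `R`-module `Hom*(X, Y)` at the homogeneous
prime `p` vanishes: every element is annihilated by some homogeneous `s ∉ p`. -/
def LocVanishes (A : CenterAction 𝒜 T) (p : SpecR 𝒜) (X Y : T) : Prop :=
  ∀ (n : ℤ) (f : X ⟶ Y⟦n⟧), ∃ (i : ℤ) (s : R) (hs : s ∈ 𝒜 i),
    s ∉ p.1.toIdeal ∧ A.hsmul hs f = 0

variable (T) in
/-- The subcategory `T_V` of `V`-torsion objects, for `V ⊆ Spec R` specialization closed. -/
def TVset (A : CenterAction 𝒜 T) (V : Set (SpecR 𝒜)) : Set T :=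
  {X | ∀ C : T, IsCompactObj T C → ∀ p : SpecR 𝒜, p ∉ V → LocVanishes A p C X}

/-- The local cohomology and localization functors `Γ_V`, `L_V` attached to the `R`-action on
`T`: for each specialization closed `V ⊆ Spec R`, `L_V` is the (essentially unique) localization
functor with `Ker L_V = T_V`, and `Γ_V` is defined by the exact localization triangle
`Γ_V X → X → L_V X → `. -/
structure BIKData (A : CenterAction 𝒜 T) where
  Γ : Set (SpecR 𝒜) → T ⥤ T
  Lf : Set (SpecR 𝒜) → T ⥤ T
  γ : ∀ V : Set (SpecR 𝒜), Γ V ⟶ 𝟭 T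
  η : ∀ V : Set (SpecR 𝒜), 𝟭 T ⟶ Lf V
  δ : ∀ (V : Set (SpecR 𝒜)) (X : T), (Lf V).obj X ⟶ ((Γ V).obj X)⟦(1 : ℤ)⟧
  tri : ∀ V : Set (SpecR 𝒜), SpecClosed V → ∀ X : T,
    Triangle.mk ((γ V).app X) ((η V).app X) (δ V X) ∈ distTriang T
  Lη_iso : ∀ V : Set (SpecR 𝒜), SpecClosed V → ∀ X : T,
    IsIso ((Lf V).map ((η V).app X))
  Lη_eq : ∀ V : Set (SpecR 𝒜), SpecClosed V → ∀ X : T,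
    (Lf V).map ((η V).app X) = (η V).app ((Lf V).obj X)
  kerL : ∀ V : Set (SpecR 𝒜), SpecClosed V → ∀ X : T,
    Limits.IsZero ((Lf V).obj X) ↔ X ∈ TVset T A V

namespace BIKData

variable {A : CenterAction 𝒜 T} (B : BIKData A)

/-- `X_p = L_{Z(p)} X`. -/
def locP (p : SpecR 𝒜) (X : T) : T := (B.Lf (Zset p)).obj X

/-- `Γ_p = Γ_{V(p)} ∘ L_{Z(p)}`. -/
def ΓP (p : SpecR 𝒜) : T ⥤ T := B.Lf (Zset p) ⋙ B.Γ (Vp p)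

/-- `supp_R X = { p ∈ Spec R | Γ_p X ≠ 0 }`. -/
def suppObj (X : T) : Set (SpecR 𝒜) := {p | ¬ Limits.IsZero ((B.ΓP p).obj X)}

/-- `supp_R T = ⋃_X supp_R X`. -/
def suppT : Set (SpecR 𝒜) := {p | ∃ X : T, p ∈ B.suppObj X}

/-- The support of a class of objects. -/
def suppSet (S : Set T) : Set (SpecR 𝒜) := ⋃ X ∈ S, B.suppObj X

/-- `supp_R⁻¹ U`, the class of objects supported in `U`. -/
def invSupp (U : Set (SpecR 𝒜)) : Set T := {X | B.suppObj X ⊆ U}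

/-- `Γ_p T`, the essential image of `Γ_p`. -/
def ΓPImage (p : SpecR 𝒜) : Set T := {X | ∃ Y : T, Nonempty (X ≅ (B.ΓP p).obj Y)}

/-- The local-global principle: each object is built from its local cohomology objects. -/
def LocalGlobal : Prop :=
  ∀ X : T, Loc T {X} = Loc T {Y | ∃ p : SpecR 𝒜, Y = (B.ΓP p).obj X}

end BIKData

/-- A localizing subcategory is minimal if it is nonzero and has no proper nonzero localizing
subcategories. -/
def IsMinimalLoc (S : Set T) : Prop :=
  IsLocalizing T S ∧ (∃ X ∈ S, ¬ Limits.IsZero X) ∧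
    ∀ S' : Set T, IsLocalizing T S' → S' ⊆ S →
      (∀ X ∈ S', Limits.IsZero X) ∨ S' = S

/-- `T` is stratified by the `R`-action: the local-global principle holds and each `Γ_p T`
is either zero or a minimal localizing subcategory. -/
def Stratified {A : CenterAction 𝒜 T} (B : BIKData A) : Prop :=
  B.LocalGlobal ∧
    ∀ p : SpecR 𝒜, (∀ X ∈ B.ΓPImage p, Limits.IsZero X) ∨ IsMinimalLoc (B.ΓPImage p)

/-- A graded `R`-submodule of `Hom*(X,Y)`. -/
structure HomSub (A : CenterAction 𝒜 T) (X Y : T) where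
  car : ∀ n : ℤ, AddSubgroup (X ⟶ Y⟦n⟧)
  hsmul_mem : ∀ (i : ℤ) (a : R) (ha : a ∈ 𝒜 i) (n : ℤ) (f : X ⟶ Y⟦n⟧),
    f ∈ car n → A.hsmul ha f ∈ car (n + i)

/-- The graded `R`-module `Hom*(X,Y)` is finitely generated. -/
def FGHom (A : CenterAction 𝒜 T) (X Y : T) : Prop :=
  ∃ F : Finset ((n : ℤ) × (X ⟶ Y⟦n⟧)),
    ∀ S : HomSub A X Y, (∀ g ∈ F, g.2 ∈ S.car g.1) → ∀ (n : ℤ) (f : X ⟶ Y⟦n⟧), f ∈ S.car n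

/-- The `R`-linear category `T` is noetherian: `End*(C)` is a finitely generated `R`-module
for each compact object `C`. -/
def NoetherianT (A : CenterAction 𝒜 T) : Prop :=
  ∀ C : T, IsCompactObj T C → FGHom A C C

end Action

section Extra

variable {R : Type u} [Ring R] {𝒜 : ℤ → AddSubgroup R} [GradedRing 𝒜]
variable {T : Type u'} [Category.{v} T] [HasZeroObject T] [Preadditive T] [HasShift T ℤ]
  [∀ n : ℤ, (CategoryTheory.shiftFunctor T n).Additive] [Pretriangulated T]
  [HasCoproducts.{v} T]

/-- A subset of `Spec R` closed under generalization. -/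
def GenClosed (U : Set (SpecR 𝒜)) : Prop :=
  ∀ p q : SpecR 𝒜, q ∈ U → p.1.toIdeal ≤ q.1.toIdeal → p ∈ U

/-- `Supp_R Hom*(X,Y) = { p | Hom*(X,Y)_p ≠ 0 }`, the big support of the graded `R`-module
`Hom*(X,Y)`. -/
def bigSuppHom (A : CenterAction 𝒜 T) (X Y : T) : Set (SpecR 𝒜) :=
  {p | ¬ LocVanishes A p X Y}

/-- `Supp_R X = ⋃_{C compact} Supp_R Hom*(C,X)`, the big support of an object. -/
def bigSuppObj (A : CenterAction 𝒜 T) (X : T) : Set (SpecR 𝒜) :=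
  {p | ∃ C : T, IsCompactObj T C ∧ ¬ LocVanishes A p C X}

/-- The graded `R`-module `Hom*(X,Y)` is `p`-local: every homogeneous element outside of `p`
acts invertibly on it. -/
def PLocalHom (A : CenterAction 𝒜 T) (p : SpecR 𝒜) (X Y : T) : Prop :=
  ∀ (i : ℤ) (s : R) (hs : s ∈ 𝒜 i), s ∉ p.1.toIdeal →
    ∀ n : ℤ, Function.Bijective fun f : X ⟶ Y⟦n⟧ => A.hsmul hs f

/-- `K` is a Koszul object `X ⫽ a` of the homogeneous element `a` of degree `i` on `X`,
i.e. there is an exact triangle `X → Σ^i X → K → `, the first map being given by the action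
of `a`. -/
def IsKoszul (A : CenterAction 𝒜 T) {i : ℤ} (a : R) (ha : a ∈ 𝒜 i) (X K : T) : Prop :=
  ∃ (w : X⟦i⟧ ⟶ K) (d : K ⟶ X⟦(1 : ℤ)⟧),
    Triangle.mk (A.act i a ha X) w d ∈ distTriang T

/-- Iterated Koszul object on a finite sequence of homogeneous elements. -/
inductive IsKoszulSeq (A : CenterAction 𝒜 T) :
    T → List ((i : ℤ) × {a : R // a ∈ 𝒜 i}) → T → Prop
  | nil (X : T) : IsKoszulSeq A X [] X
  | cons (X Y K : T) (i : ℤ) (a : {a : R // a ∈ 𝒜 i})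
      (l : List ((i : ℤ) × {a : R // a ∈ 𝒜 i})) :
      IsKoszulSeq A X l Y → IsKoszul A a.1 a.2 Y K → IsKoszulSeq A X (⟨i, a⟩ :: l) K

/-- `K` is a Koszul object `X ⫽ 𝔞` of the homogeneous ideal `𝔞` on `X`, obtained by iterating
the Koszul construction on some finite sequence of homogeneous generators of `𝔞`. -/
def IsKoszulIdeal (A : CenterAction 𝒜 T) (𝔞 : HomogeneousIdeal 𝒜) (X K : T) : Prop :=
  ∃ l : List ((i : ℤ) × {a : R // a ∈ 𝒜 i}),
    Ideal.span {x : R | ∃ s ∈ l, (s.2 : R) = x} = 𝔞.toIdeal ∧ IsKoszulSeq A X l K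

end Extra

section Hocolim

variable {T : Type u'} [Category.{v} T] [Preadditive T] [HasCoproductsOfShape ℕ T]

/-- The map `⊕ₙ Xₙ → ⊕ₙ Xₙ` given by `id - fₙ`, whose cone is the homotopy colimit. -/
noncomputable def hoColimMap {Xs : ℕ → T} (fs : ∀ n, Xs n ⟶ Xs (n + 1)) : (∐ Xs) ⟶ (∐ Xs) :=
  Sigma.desc fun n => Sigma.ι Xs n - fs n ≫ Sigma.ι Xs (n + 1)

variable [HasZeroObject T] [HasShift T ℤ]
  [∀ n : ℤ, (CategoryTheory.shiftFunctor T n).Additive] [Pretriangulated T]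

/-- A homotopy colimit of the sequence `X₀ → X₁ → X₂ → ⋯`, defined by an exact triangle
`⊕ Xₙ → ⊕ Xₙ → hocolim Xₙ → `. -/
structure HocolimData (Xs : ℕ → T) (fs : ∀ n, Xs n ⟶ Xs (n + 1)) where
  pt : T
  ι : (∐ Xs) ⟶ pt
  d : pt ⟶ (∐ Xs)⟦(1 : ℤ)⟧
  tri : Triangle.mk (hoColimMap fs) ι d ∈ distTriang T

end Hocolim

end BIK

namespace BIKP
open BIK

section Alg

variable {R : Type u} [Ring R] (𝒜 : ℤ → AddSubgroup R) [GradedRing 𝒜]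

open Classical in
/-- projection onto the degrees satisfying `P`. -/
noncomputable def prj (P : ℤ → Prop) : R →+ R :=
  (DirectSum.toAddMonoid (fun i => if P i then (𝒜 i).subtype else 0)).comp
    (DirectSum.decomposeAddEquiv 𝒜).toAddMonoidHom

open Classical in
lemma prj_of_mem (P : ℤ → Prop) {i : ℤ} {x : R} (hx : x ∈ 𝒜 i) :
    prj 𝒜 P x = if P i then x else 0 := by
  have : DirectSum.decompose 𝒜 x = DirectSum.of (fun i => 𝒜 i) i ⟨x, hx⟩ :=
    DirectSum.decompose_of_mem 𝒜 hx
  simp only [prj, AddMonoidHom.comp_apply, AddEquiv.coe_toAddMonoidHom,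
    DirectSum.decomposeAddEquiv_apply]
  rw [this, DirectSum.toAddMonoid_of]
  split_ifs <;> simp

lemma prj_pos {P : ℤ → Prop} {i : ℤ} {x : R} (hx : x ∈ 𝒜 i) (h : P i) :
    prj 𝒜 P x = x := by rw [prj_of_mem 𝒜 P hx, if_pos h]

lemma prj_neg {P : ℤ → Prop} {i : ℤ} {x : R} (hx : x ∈ 𝒜 i) (h : ¬ P i) :
    prj 𝒜 P x = 0 := by rw [prj_of_mem 𝒜 P hx, if_neg h]

lemma prj_idem (P : ℤ → Prop) (x : R) : prj 𝒜 P (prj 𝒜 P x) = prj 𝒜 P x := by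
  induction x using DirectSum.Decomposition.inductionOn 𝒜 with
  | zero => simp
  | homogeneous m =>
    rename_i i
    by_cases h : P i
    · simp [prj_pos 𝒜 m.2 h]
    · simp [prj_neg 𝒜 m.2 h]
  | add a b ha hb => simp [ha, hb]

lemma prj_add_prj (x : R) : prj 𝒜 Even x + prj 𝒜 (fun i => ¬ Even i) x = x := by
  induction x using DirectSum.Decomposition.inductionOn 𝒜 with
  | zero => simp
  | homogeneous m =>
    rename_i i
    by_cases h : Even i
    · rw [prj_pos 𝒜 m.2 h, prj_neg 𝒜 m.2 (by simpa using h), add_zero]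
    · rw [prj_neg 𝒜 m.2 h, prj_pos (P := fun i => ¬ Even i) 𝒜 m.2 h, zero_add]
  | add a b ha hb =>
    rw [map_add, map_add, add_add_add_comm, ha, hb]

lemma prj_mul (P : ℤ → Prop) (hP : ∀ i j, P j → (P (i + j) ↔ Even i)) (r x : R) :
    prj 𝒜 P (r * prj 𝒜 P x) = prj 𝒜 Even r * prj 𝒜 P x := by
  induction x using DirectSum.Decomposition.inductionOn 𝒜 with
  | zero => simp
  | homogeneous m =>
    rename_i j
    by_cases h : P j
    · rw [prj_pos 𝒜 m.2 h]
      induction r using DirectSum.Decomposition.inductionOn 𝒜 with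
      | zero => simp
      | homogeneous n =>
        rename_i i
        by_cases h' : Even i
        · rw [prj_pos 𝒜 n.2 h', prj_pos 𝒜 (SetLike.mul_mem_graded n.2 m.2) ((hP i j h).2 h')]
        · rw [prj_neg 𝒜 n.2 h', prj_neg 𝒜 (SetLike.mul_mem_graded n.2 m.2)
            (fun h2 => h' ((hP i j h).1 h2)), zero_mul]
      | add a b ha hb => simp [add_mul, ha, hb]
    · simp [prj_neg 𝒜 m.2 h]
  | add a b ha hb => simp [mul_add, ha, hb]

lemma even_hP : ∀ i j : ℤ, Even j → (Even (i + j) ↔ Even i) := by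
  intro i j h; simp [Int.even_add, h]
lemma odd_hP : ∀ i j : ℤ, ¬ Even j → (¬ Even (i + j) ↔ Even i) := by
  intro i j h; simp only [Int.even_add]; tauto

lemma prj_mul' (P : ℤ → Prop) (hP : ∀ i j, P (i + j) ↔ ((Even i) ↔ P j)) (r x : R)
     : prj 𝒜 P (prj 𝒜 Even r * x) = prj 𝒜 Even r * prj 𝒜 P x := by
  induction x using DirectSum.Decomposition.inductionOn 𝒜 with
  | zero => simp
  | homogeneous m =>
    rename_i j
    induction r using DirectSum.Decomposition.inductionOn 𝒜 with
    | zero => simp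
    | homogeneous n =>
      rename_i i
      by_cases h' : Even i
      · rw [prj_pos 𝒜 n.2 h']
        by_cases h : P j
        · rw [prj_pos 𝒜 m.2 h, prj_pos 𝒜 (SetLike.mul_mem_graded n.2 m.2)]
          exact (hP i j).2 (by tauto)
        · rw [prj_neg 𝒜 m.2 h, prj_neg 𝒜 (SetLike.mul_mem_graded n.2 m.2), mul_zero]
          exact fun h2 => h (((hP i j).1 h2).1 h')
      · rw [prj_neg 𝒜 n.2 h', zero_mul, zero_mul, map_zero]
    | add a b ha hb => simp [add_mul, ha, hb]
  | add a b ha hb => simp [mul_add, ha, hb]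

/-- The even part of `R`. -/
noncomputable def evenSub : Subring R where
  carrier := {r | prj 𝒜 Even r = r}
  mul_mem' := by
    intro a b ha hb
    have ha' : prj 𝒜 Even a = a := ha
    have hb' : prj 𝒜 Even b = b := hb
    have := prj_mul 𝒜 Even even_hP a b
    rw [hb', ha'] at this
    exact this
  one_mem' := prj_pos 𝒜 (SetLike.one_mem_graded 𝒜) (by simp)
  add_mem' := by
    intro a b ha hb
    have ha' : prj 𝒜 Even a = a := ha
    have hb' : prj 𝒜 Even b = b := hb
    show prj 𝒜 Even (a + b) = a + b
    rw [map_add, ha', hb']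
  zero_mem' := map_zero _
  neg_mem' := by
    intro a ha
    have ha' : prj 𝒜 Even a = a := ha
    show prj 𝒜 Even (-a) = -a
    rw [map_neg, ha']

lemma mem_evenSub {r : R} : r ∈ evenSub 𝒜 ↔ prj 𝒜 Even r = r := Iff.rfl

variable {𝒜} in
lemma mem_evenSub_of_even {r : R} {i : ℤ} (hr : r ∈ 𝒜 i) (hi : Even i) : r ∈ evenSub 𝒜 :=
  prj_pos 𝒜 hr hi

lemma even_central (hcomm : IsGradedComm 𝒜) {a : R} (ha : a ∈ evenSub 𝒜) (x : R) :
    a * x = x * a := by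
  suffices ∀ r x, prj 𝒜 Even r * x = x * prj 𝒜 Even r by
    have := this a x
    rwa [(mem_evenSub 𝒜).1 ha] at this
  intro r x
  induction x using DirectSum.Decomposition.inductionOn 𝒜 with
  | zero => simp
  | homogeneous m =>
    rename_i j
    induction r using DirectSum.Decomposition.inductionOn 𝒜 with
    | zero => simp
    | homogeneous n =>
      rename_i i
      by_cases h : Even i
      · rw [prj_pos 𝒜 n.2 h, hcomm i j _ _ n.2 m.2, Even.neg_one_pow, one_smul]
        simp [Int.natAbs_mul, Nat.even_mul, h]
      · rw [prj_neg 𝒜 n.2 h]; simp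
    | add a b ha hb => simp [add_mul, mul_add, ha, hb]
  | add a b ha hb => simp [add_mul, mul_add, ha, hb]

noncomputable instance evenComm [hc : Fact (IsGradedComm 𝒜)] : CommRing (evenSub 𝒜) :=
  { (inferInstance : Ring (evenSub 𝒜)) with
    mul_comm := fun a b => Subtype.ext (even_central 𝒜 hc.out a.2 b.1) }

/-- the projection as a linear map -/
noncomputable def prjL (P : ℤ → Prop) (hP : ∀ i j, P (i + j) ↔ ((Even i) ↔ P j)) :
    R →ₗ[evenSub 𝒜] R where
  toFun := prj 𝒜 P
  map_add' := map_add _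
  map_smul' := by
    intro a x
    have := prj_mul' 𝒜 P hP a.1 x
    rw [(mem_evenSub 𝒜).1 a.2] at this
    exact this

lemma noeth_range (hn : IsNoetherianRing R) (P : ℤ → Prop)
    (hP : ∀ i j, P (i + j) ↔ ((Even i) ↔ P j)) :
    IsNoetherian (evenSub 𝒜) (LinearMap.range (prjL 𝒜 P hP)) := by
  rw [isNoetherian_submodule]
  intro N hN
  have hfg : (Submodule.span R (N : Set R)).FG := hn.noetherian _
  rw [Submodule.fg_span_iff_fg_span_finset_subset] at hfg
  obtain ⟨F, hF, hspan⟩ := hfg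
  refine ⟨F, le_antisymm (Submodule.span_le.2 hF) ?_⟩
  have key : ∀ x ∈ Submodule.span R (F : Set R), ∀ r : R,
      prj 𝒜 P (r * x) ∈ Submodule.span (evenSub 𝒜) (F : Set R) := by
    intro x hx
    induction hx using Submodule.span_induction with
    | mem x hx =>
      intro r
      obtain ⟨y, hy⟩ := hN (hF hx)
      have hy' : prj 𝒜 P y = x := hy
      have h2 := prj_mul 𝒜 P (fun i j h => by rw [hP]; simp [h]) r y
      rw [hy'] at h2
      rw [h2]
      exact Submodule.smul_mem _ (⟨prj 𝒜 Even r, prj_idem 𝒜 Even r⟩ : evenSub 𝒜)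
        (Submodule.subset_span hx)
    | zero => intro r; simp
    | add x y _ _ hx hy => intro r; rw [mul_add, map_add]; exact add_mem (hx r) (hy r)
    | smul a x _ hx => intro r; rw [smul_eq_mul, ← mul_assoc]; exact hx _
  intro x hx
  have h1 : x ∈ Submodule.span R (F : Set R) := hspan ▸ Submodule.subset_span hx
  obtain ⟨y, hy⟩ := hN hx
  have hy' : prj 𝒜 P y = x := hy
  have h2 := key x h1 1
  rw [one_mul] at h2
  rwa [← hy', prj_idem, hy'] at h2

lemma isNoeth_even_R (hn : IsNoetherianRing R) : IsNoetherian (evenSub 𝒜) R := by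
  have hE : ∀ i j : ℤ, Even (i + j) ↔ (Even i ↔ Even j) := fun i j => Int.even_add
  have hO : ∀ i j : ℤ, ¬ Even (i + j) ↔ (Even i ↔ ¬ Even j) := fun i j => by
    rw [Int.even_add]; tauto
  have h1 := noeth_range 𝒜 hn _ hE
  have h2 := noeth_range 𝒜 hn (fun i => ¬ Even i) hO
  have h3 : LinearMap.range (prjL 𝒜 _ hE) ⊔ LinearMap.range (prjL 𝒜 (fun i => ¬ Even i) hO) = ⊤ := by
    rw [eq_top_iff]
    intro x _
    rw [← prj_add_prj 𝒜 x]
    exact Submodule.add_mem_sup ⟨x, rfl⟩ ⟨x, rfl⟩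
  rw [← isNoetherian_top_iff, ← h3]
  infer_instance

instance isNoeth_even [hn : Fact (IsNoetherianRing R)] [hc : Fact (IsGradedComm 𝒜)] :
    IsNoetherianRing (evenSub 𝒜) := by
  have := isNoeth_even_R 𝒜 hn.out
  exact isNoetherian_of_injective
    ({ toFun := fun a => a.1, map_add' := fun _ _ => rfl, map_smul' := fun _ _ => rfl } :
      evenSub 𝒜 →ₗ[evenSub 𝒜] R) Subtype.val_injective

lemma finite_even_R (hn : IsNoetherianRing R) : Module.Finite (evenSub 𝒜) R := by
  have := isNoeth_even_R 𝒜 hn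
  infer_instance

variable {𝒜}
/-- the even part of `p`. -/
noncomputable def p0 (p : SpecR 𝒜) : Ideal (evenSub 𝒜) := p.1.toIdeal.comap (evenSub 𝒜).subtype

lemma mem_p0 (p : SpecR 𝒜) (a : evenSub 𝒜) : a ∈ p0 p ↔ a.1 ∈ p.1.toIdeal := Iff.rfl

lemma one_notMem (p : SpecR 𝒜) : (1 : R) ∉ p.1.toIdeal :=
  fun h => p.2.ne_top ((Ideal.eq_top_iff_one _).2 h)

lemma mul_notMem (p : SpecR 𝒜) {i j : ℤ} {a b : R} (ha : a ∈ 𝒜 i) (hb : b ∈ 𝒜 j)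
    (ha' : a ∉ p.1.toIdeal) (hb' : b ∉ p.1.toIdeal) : a * b ∉ p.1.toIdeal := fun h =>
  (p.2.mem_or_mem ha hb h).elim ha' hb'

noncomputable def S0 [Fact (IsGradedComm 𝒜)] (p : SpecR 𝒜) : Submonoid (evenSub 𝒜) where
  carrier := {s | ∃ i, Even i ∧ s.1 ∈ 𝒜 i ∧ s.1 ∉ p.1.toIdeal}
  mul_mem' := by
    rintro a b ⟨i, hi, ha, ha'⟩ ⟨j, hj, hb, hb'⟩
    exact ⟨i + j, hi.add hj, SetLike.mul_mem_graded ha hb, mul_notMem p ha hb ha' hb'⟩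
  one_mem' := ⟨0, by simp, SetLike.one_mem_graded 𝒜, one_notMem p⟩

lemma S0_disj [Fact (IsGradedComm 𝒜)] (p : SpecR 𝒜) (s : evenSub 𝒜) (hs : s ∈ S0 p) : s ∉ p0 p :=
  hs.choose_spec.2.2

/-- finitely many even homogeneous elements detecting `p`. -/
lemma exists_gens [Fact (IsNoetherianRing R)] [Fact (IsGradedComm 𝒜)] (p : SpecR 𝒜) :
    ∃ F : Finset (evenSub 𝒜), (∀ x ∈ F, x ∈ p0 p ∧ ∃ i, Even i ∧ x.1 ∈ 𝒜 i) ∧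
      ∀ r : SpecR 𝒜, (∀ x ∈ F, x.1 ∈ r.1.toIdeal) → p.1.toIdeal ≤ r.1.toIdeal := by
  have hfg : (Submodule.span (evenSub 𝒜)
      {x : evenSub 𝒜 | x ∈ p0 p ∧ ∃ i, Even i ∧ x.1 ∈ 𝒜 i}).FG := IsNoetherian.noetherian _
  rw [Submodule.fg_span_iff_fg_span_finset_subset] at hfg
  obtain ⟨F, hF, hspan⟩ := hfg
  refine ⟨F, fun x hx => hF hx, fun r hr a ha => ?_⟩
  have hle : Submodule.span (evenSub 𝒜) (F : Set (evenSub 𝒜)) ≤ p0 r :=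
    Submodule.span_le.2 fun x hx => hr x hx
  rw [← hspan] at hle
  classical
  rw [← DirectSum.sum_support_decompose 𝒜 a]
  refine Ideal.sum_mem _ fun i _ => ?_
  set b : R := (DirectSum.decompose 𝒜 a i : R) with hb
  have hb1 : b ∈ p.1.toIdeal := p.1.2 i ha
  have hb2 : b ∈ 𝒜 i := (DirectSum.decompose 𝒜 a i).2
  have hbb : b * b ∈ 𝒜 (i + i) := SetLike.mul_mem_graded hb2 hb2
  have h1 := hle (Submodule.subset_span (s := {x : evenSub 𝒜 | x ∈ p0 p ∧ ∃ i, Even i ∧ x.1 ∈ 𝒜 i})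
    (show (⟨b * b, mem_evenSub_of_even hbb ⟨i, rfl⟩⟩ : evenSub 𝒜) ∈ _ from
      ⟨Ideal.mul_mem_left _ _ hb1, i + i, ⟨i, rfl⟩, hbb⟩))
  exact (r.2.mem_or_mem hb2 hb2 h1).elim id id

/-- For `p ⊄ r`, there is an even homogeneous element in `p` but not in `r`. -/
lemma exists_even_notMem (p r : SpecR 𝒜) (h : ¬ p.1.toIdeal ≤ r.1.toIdeal) :
    ∃ (a : evenSub 𝒜) (i : ℤ), Even i ∧ a.1 ∈ 𝒜 i ∧ a ∈ p0 p ∧ a.1 ∉ r.1.toIdeal := by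
  by_contra hcon
  push Not at hcon
  apply h
  intro a ha
  classical
  rw [← DirectSum.sum_support_decompose 𝒜 a]
  refine Ideal.sum_mem _ fun i _ => ?_
  set b : R := (DirectSum.decompose 𝒜 a i : R) with hb
  have hb1 : b ∈ p.1.toIdeal := p.1.2 i ha
  have hb2 : b ∈ 𝒜 i := (DirectSum.decompose 𝒜 a i).2
  have hbb : b * b ∈ 𝒜 (i + i) := SetLike.mul_mem_graded hb2 hb2
  have h1 := hcon ⟨b * b, mem_evenSub_of_even hbb ⟨i, rfl⟩⟩ (i + i) ⟨i, rfl⟩ hbb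
    (Ideal.mul_mem_left _ _ hb1)
  exact (r.2.mem_or_mem hb2 hb2 h1).elim id id

/-- even homogeneous component of a non-member -/
lemma pow_notMem (p : SpecR 𝒜) {i : ℤ} {a : R} (ha : a ∈ 𝒜 i) (ha' : a ∉ p.1.toIdeal) (n : ℕ) :
    a ^ n ∉ p.1.toIdeal := by
  induction n with
  | zero => rw [pow_zero]; exact one_notMem p
  | succ n ih => rw [pow_succ]; exact mul_notMem p (SetLike.pow_mem_graded n ha) ha ih ha'

lemma comp_mem_even (a : R) (ha : a ∈ evenSub 𝒜) (i : ℤ) (hi : ¬ Even i) :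
    (DirectSum.decompose 𝒜 a i : R) = 0 := by
  suffices ∀ r, (DirectSum.decompose 𝒜 (prj 𝒜 Even r) i : R) = 0 by
    have := this a; rwa [(mem_evenSub 𝒜).1 ha] at this
  intro r
  induction r using DirectSum.Decomposition.inductionOn 𝒜 with
  | zero => simp
  | homogeneous n =>
    rename_i j
    by_cases h : Even j
    · rw [prj_pos 𝒜 n.2 h]
      exact DirectSum.decompose_of_mem_ne 𝒜 n.2 (by rintro rfl; exact hi h)
    · rw [prj_neg 𝒜 n.2 h]; simp
  | add a b ha hb => simp [ha, hb, DirectSum.decompose_add]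
end Alg
end BIKP

namespace BIKP
section Inj
variable {A : Type u} [CommRing A] (S : Submonoid A) (I : Ideal A)

/-- the `I`-torsion part of the character module of the localization. -/
def torsE : Submodule A (CharacterModule (Localization S)) where
  carrier := {c | ∃ N : ℕ, ∀ a ∈ I ^ N, a • c = 0}
  add_mem' := by
    rintro c d ⟨N, hN⟩ ⟨M, hM⟩
    refine ⟨N + M, fun a ha => ?_⟩
    rw [smul_add, hN a (Ideal.pow_le_pow_right (Nat.le_add_right _ _) ha),
      hM a (Ideal.pow_le_pow_right (Nat.le_add_left _ _) ha), add_zero]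
  zero_mem' := ⟨0, by simp⟩
  smul_mem' := by
    rintro a c ⟨N, hN⟩
    exact ⟨N, fun b hb => by rw [smul_comm, hN b hb, smul_zero]⟩

lemma torsE_baer [IsNoetherianRing A] : Module.Baer A (torsE S I) := by
  have hE0 : Module.Baer A (CharacterModule (Localization S)) :=
    Module.Flat.iff_characterModule_baer.1 (IsLocalization.flat (Localization S) S)
  intro J g
  -- a uniform power of `I` killing the image of `g`
  obtain ⟨N, hN⟩ : ∃ N : ℕ, ∀ a ∈ I ^ N, ∀ x, a • g x = 0 := by
    obtain ⟨F, hF⟩ := (Module.Finite.fg_top : (⊤ : Submodule A J).FG)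
    choose n hn using fun x : J => (g x).2
    refine ⟨F.sup n, fun a ha x => ?_⟩
    have hx : x ∈ Submodule.span A (F : Set J) := hF ▸ Submodule.mem_top
    induction hx using Submodule.span_induction with
    | mem x hx =>
      apply Subtype.ext
      exact hn x a (Ideal.pow_le_pow_right (Finset.le_sup hx) ha)
    | zero => simp
    | add x y _ _ hx hy => rw [map_add, smul_add, hx, hy, add_zero]
    | smul b x _ hx => rw [map_smul, smul_comm, hx, smul_zero]
  obtain ⟨k, hk⟩ := I.exists_pow_inf_eq_pow_smul J
  have hk' := hk (N + k) (by omega)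
  have hAR : ∀ x (hx : x ∈ J), x ∈ I ^ (N + k) → g ⟨x, hx⟩ = 0 := by
    intro x hx hxI
    have h1 : x ∈ I ^ (N + k) • (⊤ : Submodule A A) ⊓ J := ⟨by simpa using hxI, hx⟩
    rw [hk', Nat.add_sub_cancel] at h1
    have h2 : x ∈ I ^ N • (J : Submodule A A) := Submodule.smul_mono le_rfl inf_le_right h1
    clear h1 hxI
    have : ∀ x ∈ I ^ N • (J : Submodule A A), ∀ hx : x ∈ J, g ⟨x, hx⟩ = 0 := by
      intro x hx'
      induction hx' using Submodule.smul_induction_on' with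
      | smul a ha y hy =>
        intro hx
        have : (⟨a • y, hx⟩ : J) = a • (⟨y, hy⟩ : J) := rfl
        rw [this, map_smul, hN a ha]
      | add x hx1 y hy1 h1 h2 =>
        intro hx
        have hxJ : x ∈ J := Submodule.smul_le_right hx1
        have hyJ : y ∈ J := Submodule.smul_le_right hy1
        have : (⟨x + y, hx⟩ : J) = ⟨x, hxJ⟩ + ⟨y, hyJ⟩ := rfl
        rw [this, map_add, h1, h2, add_zero]
    exact this x h2 hx
  let f1 : A →ₗ.[A] CharacterModule (Localization S) := ⟨J, (torsE S I).subtype ∘ₗ g⟩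
  let f2 : A →ₗ.[A] CharacterModule (Localization S) := ⟨(I ^ (N + k) : Ideal A), 0⟩
  have hcompat : ∀ (x : f1.domain) (y : f2.domain), (x : A) = y → f1 x = f2 y := by
    rintro ⟨x, hx⟩ ⟨y, hy⟩ (rfl : x = y)
    show ((g ⟨x, hx⟩ : torsE S I) : CharacterModule (Localization S)) = 0
    rw [hAR x hx hy]; rfl
  obtain ⟨h, hh⟩ := hE0 (f1.sup f2 hcompat).domain (f1.sup f2 hcompat).toFun
  have h1 : ∀ x (hx : x ∈ J), h x = g ⟨x, hx⟩ := by
    intro x hx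
    have hl := LinearPMap.left_le_sup f1 f2 hcompat
    rw [hh x (hl.1 hx)]
    exact (hl.2 (x := ⟨x, hx⟩) (y := ⟨x, hl.1 hx⟩) rfl).symm
  have h2 : ∀ x ∈ I ^ (N + k), h x = 0 := by
    intro x hx
    have hl := LinearPMap.right_le_sup f1 f2 hcompat
    rw [hh x (hl.1 hx)]
    exact (hl.2 (x := ⟨x, hx⟩) (y := ⟨x, hl.1 hx⟩) rfl).symm
  have h3 : ∀ a, h a ∈ torsE S I := by
    intro a
    refine ⟨N + k, fun x hx => ?_⟩
    rw [← map_smul]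
    exact h2 _ (Ideal.mul_mem_right _ _ hx)
  refine ⟨h.codRestrict _ h3, fun x hx => Subtype.ext (h1 x hx)⟩

lemma torsE_small (𝔞 : Ideal A) [Small.{v} (A ⧸ 𝔞)] :
    Small.{v} {e : torsE S I // ∀ x ∈ 𝔞, x • e = 0} := by
  classical
  let F : {e : torsE S I // ∀ x ∈ 𝔞, x • e = 0} → ((A ⧸ 𝔞) × (A ⧸ 𝔞) → AddCircle (1 : ℚ)) :=
    fun e xy => if h : ∃ (a : A) (s : S), xy = (Ideal.Quotient.mk 𝔞 a, Ideal.Quotient.mk 𝔞 (s : A))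
      then e.1.1 (Localization.mk h.choose h.choose_spec.choose) else 0
  have hF : ∀ e (a : A) (s : S), F e (Ideal.Quotient.mk 𝔞 a, Ideal.Quotient.mk 𝔞 (s : A)) =
      e.1.1 (Localization.mk a s) := by
    intro e a s
    have h : ∃ (a' : A) (s' : S), (Ideal.Quotient.mk 𝔞 a, Ideal.Quotient.mk 𝔞 (s : A)) =
      (Ideal.Quotient.mk 𝔞 a', Ideal.Quotient.mk 𝔞 (s' : A)) := ⟨a, s, rfl⟩
    simp only [F]
    rw [dif_pos h]
    have h3 := h.choose_spec.choose_spec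
    set a' := h.choose
    set s' := h.choose_spec.choose
    rw [Prod.mk.injEq, Ideal.Quotient.eq, Ideal.Quotient.eq] at h3
    obtain ⟨h1, h2⟩ := h3
    have h4 : a * s' - a' * s ∈ 𝔞 := by
      have : a * s' - a' * s = s' * (a - a') - a' * (s - s') := by ring
      rw [this]
      exact sub_mem (Ideal.mul_mem_left _ _ h1) (Ideal.mul_mem_left _ _ h2)
    have h5 : Localization.mk a s - Localization.mk a' s' =
        (a * s' - a' * s) • Localization.mk (1 : A) (s * s') := by
      rw [Localization.smul_mk, Localization.sub_mk]
      congr 1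
      simp; ring
    have h6 := e.2 _ h4
    have h7 : e.1.1 (Localization.mk a s - Localization.mk a' s') = 0 := by
      rw [h5]
      have : ((a * s' - a' * s) • e.1).1 = 0 := by rw [h6]; rfl
      have h8 : (a * s' - a' * s) • (e.1.1) = 0 := this
      exact congrArg (fun z : CharacterModule (Localization S) =>
        z (Localization.mk (1 : A) (s * s'))) h8
    rw [map_sub, sub_eq_zero] at h7
    exact h7.symm
  refine small_of_injective (f := F) ?_
  intro e e' hee
  apply Subtype.ext; apply Subtype.ext
  ext x
  induction x using Localization.induction_on with
  | H y => rw [← hF, ← hF, hee]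

lemma exists_injData [IsNoetherianRing A] (hS : ∀ s ∈ S, s ∉ I) :
    ∃ (E : Type u) (_ : AddCommGroup E) (_ : Module A E),
      Module.Baer A E ∧ (∀ s ∈ S, ∀ e : E, s • e = 0 → e = 0) ∧
      (∀ e : E, ∃ N : ℕ, ∀ a ∈ I ^ N, a • e = 0) ∧
      (∃ e0 : E, e0 ≠ 0 ∧ ∀ a ∈ I, a • e0 = 0) ∧
      (∀ 𝔞 : Ideal A, Small.{v} (A ⧸ 𝔞) → Small.{v} {e : E // ∀ x ∈ 𝔞, x • e = 0}) := by
  refine ⟨torsE S I, inferInstance, inferInstance, torsE_baer S I, ?_, ?_, ?_, ?_⟩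
  · rintro s hs ⟨c, hc⟩ h
    apply Subtype.ext
    have h' : s • c = 0 := congrArg Subtype.val h
    ext x
    induction x using Localization.induction_on with
    | H y =>
      obtain ⟨a, t⟩ := y
      have h1 : Localization.mk a t = s • Localization.mk a (⟨s, hs⟩ * t) := by
        rw [Localization.smul_mk, Localization.mk_eq_mk_iff, Localization.r_iff_exists]
        refine ⟨1, ?_⟩
        simp; ring
      show c (Localization.mk a t) = 0
      rw [h1]
      exact congrArg (fun z : CharacterModule (Localization S) =>
        z (Localization.mk a (⟨s, hs⟩ * t))) h'
  · rintro ⟨c, N, hN⟩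
    exact ⟨N, fun a ha => Subtype.ext (hN a ha)⟩
  · let B := Localization S
    let q : Submodule A B := (I.map (algebraMap A B)).restrictScalars A
    have hq : (1 : B) ∉ q := by
      intro h
      have h' : (1 : B) ∈ I.map (algebraMap A B) := h
      rw [← map_one (algebraMap A B), IsLocalization.algebraMap_mem_map_algebraMap_iff S] at h'
      obtain ⟨m, hm, hmI⟩ := h'
      exact hS m hm (by simpa using hmI)
    have hne : (q.mkQ 1) ≠ 0 := by
      intro h; exact hq ((Submodule.Quotient.mk_eq_zero q).1 h)
    obtain ⟨c, hc⟩ := CharacterModule.exists_character_apply_ne_zero_of_ne_zero hne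
    have hk : ∀ a ∈ I, a • CharacterModule.dual q.mkQ c = 0 := by
      intro a ha
      ext x
      show c (q.mkQ (a • x)) = 0
      have : q.mkQ (a • x) = 0 := by
        rw [Submodule.mkQ_apply, Submodule.Quotient.mk_eq_zero]
        show a • x ∈ I.map (algebraMap A B)
        rw [Algebra.smul_def]
        exact Ideal.mul_mem_right _ _ (Ideal.mem_map_of_mem _ ha)
      rw [this, map_zero]
    refine ⟨⟨CharacterModule.dual q.mkQ c, 1, fun a ha => hk a (by simpa using ha)⟩, ?_,
      fun a ha => Subtype.ext (hk a ha)⟩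
    intro h
    apply hc
    have := congrArg (fun z => z.1 (1 : B)) h
    exact this
  · intro 𝔞 _
    exact torsE_small S I 𝔞
end Inj
end BIKP

namespace BIKP
open BIK
section Cat
variable {T : Type u'} [Category.{v} T] [HasZeroObject T] [Preadditive T] [HasShift T ℤ]
  [∀ n : ℤ, (CategoryTheory.shiftFunctor T n).Additive] [Pretriangulated T]
  [HasCoproducts.{v} T]

/-! ### compact objects -/

open Classical in
/-- finite support of a morphism to a coproduct -/
def FS {C : T} {J : Type v} (f : J → T) (g : C ⟶ ∐ f) : Prop :=
  ∃ s : Finset J, g = ∑ j ∈ s, g ≫ Sigma.π f j ≫ Sigma.ι f j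

lemma FS.add {C : T} {J : Type v} {f : J → T} {g h : C ⟶ ∐ f} (hg : FS f g) (hh : FS f h) :
    FS f (g + h) := by
  classical
  suffices H : ∀ g : C ⟶ ∐ f, FS f g → ∃ s : Finset J, ∀ t, s ⊆ t →
      g = ∑ j ∈ t, g ≫ Sigma.π f j ≫ Sigma.ι f j by
    obtain ⟨s, hs⟩ := H g hg
    obtain ⟨t, ht⟩ := H h hh
    refine ⟨s ∪ t, ?_⟩
    have h1 := hs (s ∪ t) Finset.subset_union_left
    have h2 := ht (s ∪ t) Finset.subset_union_right
    simp only [Preadditive.add_comp, Finset.sum_add_distrib]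
    conv_lhs => rw [h1, h2]
  rintro g ⟨s, hs⟩
  refine ⟨s, fun t hst => ?_⟩
  rw [← Finset.sum_subset hst]
  · convert hs
  · intro j _ hj
    have : g ≫ Sigma.π f j = 0 := by
      rw [hs, Preadditive.sum_comp]
      refine Finset.sum_eq_zero fun k hk => ?_
      have hkj : k ≠ j := by rintro rfl; exact hj hk
      have := Sigma.ι_π_of_ne f hkj
      simp only [Category.assoc]
      convert comp_zero using 2
      convert comp_zero using 2
      
    rw [← Category.assoc, this, zero_comp]

lemma FS.zero {C : T} {J : Type v} {f : J → T} : FS f (0 : C ⟶ ∐ f) := ⟨∅, by simp⟩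

lemma FS.ι {C : T} {J : Type v} {f : J → T} {j : J} (h : C ⟶ f j) : FS f (h ≫ Sigma.ι f j) := by
  classical
  refine ⟨{j}, ?_⟩
  rw [Finset.sum_singleton]
  have := Sigma.ι_π_eq_id f j
  simp only [Category.assoc]
  congr 1
  rw [← Category.assoc]
  symm
  convert Category.id_comp _ 

lemma FS.sum {C : T} {J : Type v} {f : J → T} {K : Type*} (s : Finset K) (g : K → (C ⟶ ∐ f))
    (h : ∀ k ∈ s, FS f (g k)) : FS f (∑ k ∈ s, g k) := by
  classical
  induction s using Finset.induction_on with
  | empty => simpa using FS.zero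
  | insert a s ha ih =>
    rw [Finset.sum_insert ha]
    exact (h a (by simp)).add (ih fun k hk => h k (by simp [hk]))

lemma FS.comp {C C' : T} {J : Type v} {f : J → T} {g : C ⟶ ∐ f} (h : FS f g) (u : C' ⟶ C) :
    FS f (u ≫ g) := by
  obtain ⟨s, hs⟩ := h
  refine ⟨s, ?_⟩
  conv_lhs => rw [hs]
  simp [Preadditive.comp_sum]

lemma sigmaHom_of (C : T) {J : Type v} [DecidableEq J] (f : J → T) (j : J) (g : C ⟶ f j) :
    sigmaHom T C f (DirectSum.of (fun j => C ⟶ f j) j g) = g ≫ Sigma.ι f j := by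
  have : ‹DecidableEq J› = Classical.decEq J := Subsingleton.elim _ _
  subst this
  letI := Classical.decEq J
  exact DirectSum.toAddMonoid_of _ _ _

lemma compact_FS {C : T} (hC : IsCompactObj T C) {J : Type v} (f : J → T) (g : C ⟶ ∐ f) :
    FS f g := by
  classical
  obtain ⟨d, rfl⟩ := (hC J f).2 g
  induction d using DirectSum.induction_on with
  | zero => rw [map_zero]; exact FS.zero
  | of j h => rw [sigmaHom_of]; exact FS.ι h
  | add a b ha hb => rw [map_add]; exact ha.add hb

lemma compact_of_FS {C : T} (h : ∀ (J : Type v) (f : J → T) (g : C ⟶ ∐ f), FS f g) :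
    IsCompactObj T C := by
  classical
  intro J f
  constructor
  · rw [injective_iff_map_eq_zero]
    intro d hd
    have key : ∀ (d : DirectSum J fun j => (C ⟶ f j)) (j : J),
        sigmaHom T C f d ≫ Sigma.π f j = d j := by
      intro d j
      induction d using DirectSum.induction_on with
      | zero => simp
      | of k h =>
        rw [sigmaHom_of, Category.assoc]
        by_cases hkj : k = j
        · subst hkj; rw [Sigma.ι_π_eq_id]; simp
        · rw [Sigma.ι_π_of_ne f hkj, DirectSum.of_eq_of_ne _ _ _ (Ne.symm hkj)]; simp
      | add a b ha hb => simp [ha, hb]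
    ext j
    rw [← key, hd]; simp
  · intro g
    obtain ⟨s, hs⟩ := h J f g
    refine ⟨∑ j ∈ s, DirectSum.of (fun j => C ⟶ f j) j (g ≫ Sigma.π f j), ?_⟩
    rw [map_sum]
    conv_rhs => rw [hs]
    refine Finset.sum_congr rfl fun j _ => ?_
    rw [sigmaHom_of, Category.assoc]

lemma sigmaComparison_π (F : T ⥤ T) [F.PreservesZeroMorphisms] {J : Type v} [DecidableEq J] (f : J → T) (j : J) :
    sigmaComparison F f ≫ F.map (Sigma.π f j) = Sigma.π (fun j => F.obj (f j)) j := by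
  ext k
  rw [ι_comp_sigmaComparison_assoc, ← F.map_comp]
  by_cases hkj : k = j
  · subst hkj; simp
  · rw [Sigma.ι_π_of_ne f hkj, Sigma.ι_π_of_ne _ hkj, F.map_zero]

lemma compact_shift {C : T} (hC : IsCompactObj T C) (n : ℤ) : IsCompactObj T (C⟦n⟧) := by
  classical
  apply compact_of_FS
  intro J f g
  let F := shiftFunctor T (-n)
  let θ := sigmaComparison F f
  let e : C ⟶ (C⟦n⟧)⟦-n⟧ := (shiftFunctorCompIsoId T n (-n) (by omega)).inv.app C
  obtain ⟨s, hs⟩ := compact_FS hC (fun j => F.obj (f j)) (e ≫ F.map g ≫ inv θ)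
  refine ⟨s, ?_⟩
  apply F.map_injective
  rw [← cancel_epi e, ← cancel_mono (inv θ), Category.assoc, hs, F.map_sum, Preadditive.comp_sum,
    Preadditive.sum_comp]
  refine Finset.sum_congr rfl fun j _ => ?_
  have h1 : inv θ ≫ Sigma.π (fun j => F.obj (f j)) j = F.map (Sigma.π f j) := by
    rw [IsIso.inv_comp_eq]; exact (sigmaComparison_π F f j).symm
  have h2 : Sigma.ι (fun j => F.obj (f j)) j = F.map (Sigma.ι f j) ≫ inv θ := by
    rw [IsIso.eq_comp_inv]; exact ι_comp_sigmaComparison F f j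
  have h1' := congrArg (fun z => z ≫ Sigma.ι (fun j => F.obj (f j)) j) h1
  simp only [Category.assoc, Functor.map_comp] at h1' ⊢
  refine congrArg (fun z => e ≫ F.map g ≫ z) ?_
  refine Eq.trans ?_ (h1'.trans ?_)
  · congr!
  · rw [h2]

lemma compact_iso {C C' : T} (e : C ≅ C') (hC : IsCompactObj T C) : IsCompactObj T C' := by
  apply compact_of_FS
  intro J f g
  have := (compact_FS hC f (e.hom ≫ g)).comp e.inv
  simpa using this

lemma compact_cone (Tr : Triangle T) (hTr : Tr ∈ distTriang T) (h1 : IsCompactObj T Tr.obj₁)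
    (h2 : IsCompactObj T Tr.obj₂) : IsCompactObj T Tr.obj₃ := by
  classical
  apply compact_of_FS
  intro J f g
  obtain ⟨s, hs⟩ := compact_FS h2 f (Tr.mor₂ ≫ g)
  have hk : ∀ j, ∃ k : Tr.obj₃ ⟶ f j, k = g ≫ Sigma.π f j := fun j => ⟨_, rfl⟩
  have h0 : Tr.mor₂ ≫ (g - ∑ j ∈ s, (g ≫ Sigma.π f j) ≫ Sigma.ι f j) = 0 := by
    rw [Preadditive.comp_sub, sub_eq_zero, Preadditive.comp_sum]
    conv_lhs => rw [hs]
    simp only [Category.assoc]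
  obtain ⟨l, hl⟩ := Triangle.yoneda_exact₃ Tr hTr _ h0
  have : g = ∑ j ∈ s, (g ≫ Sigma.π f j) ≫ Sigma.ι f j + Tr.mor₃ ≫ l := by
    rw [← hl]; abel
  rw [this]
  exact (FS.sum _ _ fun j _ => FS.ι _).add ((compact_FS (compact_shift h1 1) f l).comp _)

/-! ### localizing subcategories -/
lemma IsLocalizing.obj1 {S : Set T} (hS : IsLocalizing T S) (Tr : Triangle T)
    (hTr : Tr ∈ distTriang T) (h2 : Tr.obj₂ ∈ S) (h3 : Tr.obj₃ ∈ S) : Tr.obj₁ ∈ S := by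
  have h := hS.ext_mem _ (rot_of_distTriang _ hTr) h2 h3
  exact hS.iso_mem ((shiftFunctorCompIsoId T (1 : ℤ) (-1) (by omega)).app Tr.obj₁)
    (hS.shift_mem _ h (-1))

lemma Loc_isLoc (A : Set T) : IsLocalizing T (Loc T A) where
  zero_mem X hX S hS := hS.1.zero_mem X hX
  iso_mem e hX S hS := hS.1.iso_mem e (hX S hS)
  shift_mem X hX n S hS := hS.1.shift_mem X (hX S hS) n
  ext_mem Tr hTr h1 h2 S hS := hS.1.ext_mem Tr hTr (h1 S hS) (h2 S hS)
  coprod_mem J f hf S hS := hS.1.coprod_mem J f fun j => hf j S hS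

lemma subset_Loc (A : Set T) : A ⊆ Loc T A := fun _ hX _ hS => hS.2 hX

lemma Loc_le {A S : Set T} (hS : IsLocalizing T S) (h : A ⊆ S) : Loc T A ⊆ S :=
  fun _ hX => hX S ⟨hS, h⟩

/-! ### orthogonality -/
/-- `Hom*(X,Y) = 0`. -/
def Orth (X Y : T) : Prop := ∀ (n : ℤ) (f : X ⟶ Y⟦n⟧), f = 0

lemma Orth.dbl {X Y : T} (h : Orth X Y) (m n : ℤ) (f : X⟦m⟧ ⟶ Y⟦n⟧) : f = 0 := by
  apply (shiftFunctor T (-m)).map_injective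
  have := h (n + -m) ((shiftFunctorCompIsoId T m (-m) (by omega)).inv.app X ≫
    (shiftFunctor T (-m)).map f ≫ (shiftFunctorAdd T n (-m)).inv.app Y)
  rw [Functor.map_zero]
  rw [← cancel_epi ((shiftFunctorCompIsoId T m (-m) (by omega)).inv.app X),
    ← cancel_mono ((shiftFunctorAdd T n (-m)).inv.app Y), Category.assoc, this]
  simp

lemma Orth.zero {X Y : T} (h : Orth X Y) (f : X ⟶ Y) : f = 0 := by
  have := h 0 (f ≫ (shiftFunctorZero T ℤ).inv.app Y)
  rw [← cancel_mono ((shiftFunctorZero T ℤ).inv.app Y), this]; simp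

lemma Orth.left0 {X Y : T} (h : Orth X Y) (m : ℤ) (f : X⟦m⟧ ⟶ Y) : f = 0 := by
  have := h.dbl m 0 (f ≫ (shiftFunctorZero T ℤ).inv.app Y)
  rw [← cancel_mono ((shiftFunctorZero T ℤ).inv.app Y), this]; simp

lemma Orth.of_left {X Y : T} (h : ∀ (m : ℤ) (f : X⟦m⟧ ⟶ Y), f = 0) : Orth X Y := by
  intro n f
  apply (shiftFunctor T (-n)).map_injective
  have := h (-n) ((shiftFunctor T (-n)).map f ≫ (shiftFunctorCompIsoId T n (-n) (by omega)).hom.app Y)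
  rw [Functor.map_zero]
  rw [← cancel_mono ((shiftFunctorCompIsoId T n (-n) (by omega)).hom.app Y), this]; simp

lemma Orth.shift_right {X Y : T} (h : Orth X Y) (k : ℤ) : Orth X (Y⟦k⟧) := by
  intro n f
  have := h (k + n) (f ≫ (shiftFunctorAdd T k n).inv.app Y)
  rw [← cancel_mono ((shiftFunctorAdd T k n).inv.app Y), this]; simp

lemma Orth.shift_left {X Y : T} (h : Orth X Y) (k : ℤ) : Orth (X⟦k⟧) Y := h.dbl k

lemma Orth.iso {X Y X' Y' : T} (h : Orth X Y) (e : X' ≅ X) (e' : Y ≅ Y') : Orth X' Y' := by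
  intro n f
  have := h n (e.inv ≫ f ≫ e'.inv⟦n⟧')
  rw [← cancel_epi e.inv, ← cancel_mono (e'.inv⟦n⟧'), Category.assoc, this]; simp

lemma orth_right_loc {D : T} (hD : IsCompactObj T D) : IsLocalizing T {Y | Orth D Y} where
  zero_mem X hX := .of_left fun m f => hX.eq_of_tgt _ _
  iso_mem e h := h.iso (Iso.refl _) e
  shift_mem X h n := h.shift_right n
  ext_mem Tr hTr h1 h2 := .of_left fun m f => by
    obtain ⟨g, rfl⟩ := Triangle.coyoneda_exact₃ Tr hTr f (Orth.dbl h1 m 1 _)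
    rw [Orth.left0 h2 m g, zero_comp]
  coprod_mem J F hF := .of_left fun m f => by
    obtain ⟨s, hs⟩ := compact_FS (compact_shift hD m) F f
    rw [hs]
    refine Finset.sum_eq_zero fun j _ => ?_
    rw [← Category.assoc]
    convert zero_comp
    exact Orth.left0 (hF j) m _

lemma orth_left_loc (P : Set T) : IsLocalizing T {X | ∀ Y ∈ P, Orth X Y} where
  zero_mem X hX Y _ n f := hX.eq_of_src _ _
  iso_mem e h Y hY := (h Y hY).iso e.symm (Iso.refl _)
  shift_mem X h n Y hY := (h Y hY).shift_left n
  ext_mem Tr hTr h1 h2 Y hY n f := by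
    obtain ⟨g, rfl⟩ := Triangle.yoneda_exact₃ Tr hTr f (h2 Y hY n _)
    rw [(h1 Y hY).dbl 1 n g, comp_zero]
  coprod_mem J F hF Y hY n f := by
    ext j
    rw [comp_zero]
    exact hF j Y hY n _

/-! ### two auxiliary exactness facts -/
lemma coyoneda_exact₃_shift (Tr : Triangle T) (hTr : Tr ∈ distTriang T) {C : T} (n : ℤ)
    (k : C ⟶ Tr.obj₃⟦n⟧) (hk : k ≫ Tr.mor₃⟦n⟧' = 0) : ∃ l : C ⟶ Tr.obj₂⟦n⟧, k = l ≫ Tr.mor₂⟦n⟧' := by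
  obtain ⟨l, hl'⟩ : ∃ l : C ⟶ Tr.obj₂⟦n⟧, k = l ≫ (n.negOnePow • Tr.mor₂⟦n⟧') :=
    Triangle.coyoneda_exact₃ _ (Triangle.shift_distinguished Tr hTr n) (X := C) k
    (by
      show k ≫ (n.negOnePow • (Tr.mor₃⟦n⟧' ≫ (shiftComm Tr.obj₁ 1 n).hom)) = 0
      rw [Linear.comp_units_smul, ← Category.assoc, hk]; simp)
  refine ⟨n.negOnePow • l, ?_⟩
  rw [hl', Linear.comp_units_smul, Linear.units_smul_comp]

lemma coyoneda_exact₂_shift (Tr : Triangle T) (hTr : Tr ∈ distTriang T) {C : T} (n : ℤ)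
    (k : C ⟶ Tr.obj₂⟦n⟧) (hk : k ≫ Tr.mor₂⟦n⟧' = 0) : ∃ l : C ⟶ Tr.obj₁⟦n⟧, k = l ≫ Tr.mor₁⟦n⟧' := by
  obtain ⟨l, hl'⟩ : ∃ l : C ⟶ Tr.obj₁⟦n⟧, k = l ≫ (n.negOnePow • Tr.mor₁⟦n⟧') :=
    Triangle.coyoneda_exact₂ _ (Triangle.shift_distinguished Tr hTr n) (X := C) k
    (by
      show k ≫ (n.negOnePow • (Tr.mor₂⟦n⟧')) = 0
      rw [Linear.comp_units_smul, hk]; simp)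
  refine ⟨n.negOnePow • l, ?_⟩
  rw [hl', Linear.comp_units_smul, Linear.units_smul_comp]
end Cat
end BIKP

namespace BIKP
open BIK
section Brown
variable (T : Type u') [Category.{v} T] [HasZeroObject T] [Preadditive T] [HasShift T ℤ]
  [∀ n : ℤ, (CategoryTheory.shiftFunctor T n).Additive] [Pretriangulated T]
  [HasCoproducts.{v} T]

/-- A cohomological functor sending coproducts to products. -/
structure CohF where
  obj : T → Type w
  grp : ∀ X, AddCommGroup (obj X)
  map : ∀ {X Y : T}, (X ⟶ Y) → obj Y →+ obj X
  map_id : ∀ (X : T) (x : obj X), map (𝟙 X) x = x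
  map_comp : ∀ {X Y Z : T} (f : X ⟶ Y) (g : Y ⟶ Z) (x : obj Z), map (f ≫ g) x = map f (map g x)
  map_add : ∀ {X Y : T} (f g : X ⟶ Y) (x : obj Y), map (f + g) x = map f x + map g x
  exact' : ∀ Tr ∈ distTriang T, ∀ y : obj Tr.obj₂, map Tr.mor₁ y = 0 →
    ∃ z, map Tr.mor₂ z = y
  sigma : ∀ (J : Type v) (f : J → T) (x : ∀ j, obj (f j)),
    ∃ z : obj (∐ f), ∀ j, map (Sigma.ι f j) z = x j
  sigma_ext : ∀ (J : Type v) (f : J → T) (z : obj (∐ f)),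
    (∀ j, map (Sigma.ι f j) z = 0) → z = 0

attribute [instance] CohF.grp

variable {T} (H : CohF.{w} T)

lemma CohF.map_zero {X Y : T} (x : H.obj Y) : H.map (0 : X ⟶ Y) x = 0 := by
  have := H.map_add (0 : X ⟶ Y) 0 x
  rw [add_zero] at this
  simpa using this

lemma CohF.map_neg {X Y : T} (f : X ⟶ Y) (x : H.obj Y) : H.map (-f) x = - H.map f x := by
  have := H.map_add f (-f) x
  rw [add_neg_cancel, H.map_zero] at this
  exact eq_neg_of_add_eq_zero_right this.symm

lemma CohF.map_sub {X Y : T} (f g : X ⟶ Y) (x : H.obj Y) :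
    H.map (f - g) x = H.map f x - H.map g x := by
  rw [sub_eq_add_neg, H.map_add, H.map_neg, sub_eq_add_neg]

/-- representability at a given object -/
def RepAt {X : T} (h : H.obj X) (W : T) : Prop := Function.Bijective (fun g : W ⟶ X => H.map g h)

variable {H}

lemma RepAt.inj0 {X : T} {h : H.obj X} {W : T} (hr : RepAt H h W) (g : W ⟶ X)
    (hg : H.map g h = 0) : g = 0 := hr.1 (by simpa [H.map_zero] using hg)

lemma repAt_of {X : T} {h : H.obj X} {W : T} (h1 : ∀ g : W ⟶ X, H.map g h = 0 → g = 0)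
    (h2 : ∀ x : H.obj W, ∃ g : W ⟶ X, H.map g h = x) : RepAt H h W := by
  refine ⟨fun g g' hgg => ?_, h2⟩
  have : H.map (g - g') h = 0 := by rw [H.map_sub]; simpa [sub_eq_zero] using hgg
  exact sub_eq_zero.1 (h1 _ this)

lemma RepAt.iso {X : T} {h : H.obj X} {W W' : T} (e : W ≅ W') (hr : RepAt H h W) :
    RepAt H h W' := by
  refine repAt_of (fun g hg => ?_) fun x => ?_
  · have := hr.inj0 (e.hom ≫ g) (by rw [H.map_comp, hg, _root_.map_zero])
    rw [← cancel_epi e.hom, this, comp_zero]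
  · obtain ⟨g, hg⟩ := hr.2 (H.map e.hom x)
    refine ⟨e.inv ≫ g, ?_⟩
    have hg' : H.map g h = H.map e.hom x := hg
    rw [H.map_comp, hg', ← H.map_comp, e.inv_hom_id, H.map_id]

lemma RepAt.ext {X : T} {h : H.obj X} (Tr : Triangle T) (hTr : Tr ∈ distTriang T)
    (h1 : RepAt H h Tr.obj₁) (h2 : RepAt H h Tr.obj₂) (h1' : RepAt H h (Tr.obj₁⟦(1 : ℤ)⟧))
    (h2' : RepAt H h (Tr.obj₂⟦(1 : ℤ)⟧)) : RepAt H h Tr.obj₃ := by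
  have hrot := rot_of_distTriang _ hTr
  have hrot2 := rot_of_distTriang _ hrot
  refine repAt_of (fun g hg => ?_) fun z => ?_
  · have h3 : Tr.mor₂ ≫ g = 0 := h2.inj0 _ (by rw [H.map_comp, hg, _root_.map_zero])
    obtain ⟨k, rfl⟩ := Triangle.yoneda_exact₃ Tr hTr g h3
    rw [H.map_comp] at hg
    obtain ⟨w, hw⟩ := H.exact' _ hrot2 (H.map k h) hg
    have hw' : H.map (-Tr.mor₁⟦(1 : ℤ)⟧') w = H.map k h := hw
    obtain ⟨l, hl⟩ := h2'.2 w
    have hl' : H.map l h = w := hl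
    have hk : (-Tr.mor₁⟦(1 : ℤ)⟧') ≫ l = k := h1'.1 (by
      show H.map _ h = H.map k h
      rw [H.map_comp, hl', hw'])
    rw [← hk, ← Category.assoc, Preadditive.comp_neg, comp_distTriang_mor_zero₃₁ _ hTr]
    simp
  · obtain ⟨g, hg⟩ := h2.2 (H.map Tr.mor₂ z)
    have hg1 : H.map g h = H.map Tr.mor₂ z := hg
    have h3 : Tr.mor₁ ≫ g = 0 := h1.inj0 _ (by
      rw [H.map_comp, hg1, ← H.map_comp, comp_distTriang_mor_zero₁₂ _ hTr, H.map_zero])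
    obtain ⟨g', rfl⟩ := Triangle.yoneda_exact₂ Tr hTr g h3
    have h4 : H.map Tr.mor₂ (z - H.map g' h) = 0 := by
      rw [_root_.map_sub, ← hg1, H.map_comp, sub_self]
    obtain ⟨w, hw⟩ := H.exact' _ hrot _ h4
    have hw' : H.map Tr.mor₃ w = z - H.map g' h := hw
    obtain ⟨k, hk⟩ := h1'.2 w
    have hk' : H.map k h = w := hk
    refine ⟨g' + Tr.mor₃ ≫ k, ?_⟩
    rw [H.map_add, H.map_comp, hk', hw']; abel

lemma RepAt.sigma {X : T} {h : H.obj X} {J : Type v} (f : J → T) (hf : ∀ j, RepAt H h (f j)) :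
    RepAt H h (∐ f) := by
  refine repAt_of (fun g hg => ?_) fun x => ?_
  · ext j
    rw [comp_zero]
    exact (hf j).inj0 _ (by rw [H.map_comp, hg, _root_.map_zero])
  · choose g hg using fun j => (hf j).2 (H.map (Sigma.ι f j) x)
    refine ⟨Sigma.desc g, ?_⟩
    rw [← sub_eq_zero]
    apply H.sigma_ext
    intro j
    have hg' : H.map (g j) h = H.map (Sigma.ι f j) x := hg j
    rw [_root_.map_sub, ← H.map_comp, sub_eq_zero]
    simpa using hg'

lemma repAt_loc {X : T} (h : H.obj X) : IsLocalizing T {W | ∀ n : ℤ, RepAt H h (W⟦n⟧)} where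
  zero_mem W hW n := by
    have hz : IsZero (W⟦n⟧) := (shiftFunctor T n).map_isZero hW
    refine repAt_of (fun g _ => hz.eq_of_src _ _) fun x => ⟨0, ?_⟩
    rw [H.map_zero, ← H.map_id _ x, hz.eq_of_src (𝟙 _) 0, H.map_zero]
  iso_mem e hW n := (hW n).iso ((shiftFunctor T n).mapIso e)
  shift_mem W hW n m := (hW (n + m)).iso ((shiftFunctorAdd T n m).app W)
  ext_mem Tr hTr h1 h2 n := by
    refine RepAt.ext ((CategoryTheory.shiftFunctor (Triangle T) n).obj Tr)
      (Triangle.shift_distinguished Tr hTr n) (h1 n) (h2 n) ?_ ?_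
    · exact (h1 (n + 1)).iso ((shiftFunctorAdd T n 1).app _)
    · exact (h2 (n + 1)).iso ((shiftFunctorAdd T n 1).app _)
  coprod_mem J f hf n := by
    exact (RepAt.sigma (fun j => (f j)⟦n⟧) fun j => hf j n).iso
      (asIso (sigmaComparison (shiftFunctor T n) f))

variable (H) in
lemma brown_step {K : Type v} (G : K → T) (X : T) (h : H.obj X) :
    ∃ (X' : T) (h' : H.obj X') (u : X ⟶ X'), H.map u h' = h ∧
      ∀ k (f : G k ⟶ X), H.map f h = 0 → f ≫ u = 0 := by
  let J := Σ k : K, {f : G k ⟶ X // H.map f h = 0}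
  let F : J → T := fun j => G j.1
  let φ : (∐ F) ⟶ X := Sigma.desc fun j => j.2.1
  obtain ⟨X', u, d, htri⟩ := distinguished_cocone_triangle φ
  have h0 : H.map φ h = 0 := by
    apply H.sigma_ext
    intro j
    rw [← H.map_comp]
    simpa [φ] using j.2.2
  obtain ⟨h', hh'⟩ := H.exact' _ htri h h0
  refine ⟨X', h', u, hh', fun k f hf => ?_⟩
  have h1 : φ ≫ u = 0 := comp_distTriang_mor_zero₁₂ _ htri
  have h2 : Sigma.ι F ⟨k, f, hf⟩ ≫ φ = f := by simp [φ]
  rw [← h2, Category.assoc, h1, comp_zero]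

section hocolim
variable (X : ℕ → T) (u : ∀ n, X n ⟶ X (n + 1))

/-- the family indexed by the lifted naturals -/
abbrev XU (j : ULift.{v} ℕ) : T := X j.down

/-- the identity minus the shift -/
noncomputable def hocPhi : (∐ XU X) ⟶ (∐ XU X) :=
  Sigma.desc fun j => Sigma.ι (XU X) j - u j.down ≫ Sigma.ι (XU X) ⟨j.down + 1⟩

lemma ι_hocPhi (n : ℕ) : Sigma.ι (XU X) ⟨n⟩ ≫ hocPhi X u =
    Sigma.ι (XU X) ⟨n⟩ - (u n ≫ Sigma.ι (XU X) ⟨n + 1⟩ : X n ⟶ _) := by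
  simp [hocPhi]

open Classical in
lemma hocPhi_π0 : hocPhi X u ≫ Sigma.π (XU X) ⟨0⟩ = Sigma.π (XU X) ⟨0⟩ := by
  apply Sigma.hom_ext
  rintro ⟨n⟩
  rw [← Category.assoc, ι_hocPhi, Preadditive.sub_comp]
  rw [Category.assoc, Sigma.ι_π_of_ne (XU X) (b := ⟨n + 1⟩) (c := ⟨0⟩) (by simp)]
  simp

open Classical in
lemma hocPhi_πS (m : ℕ) : hocPhi X u ≫ Sigma.π (XU X) ⟨m + 1⟩ =
    Sigma.π (XU X) ⟨m + 1⟩ - Sigma.π (XU X) ⟨m⟩ ≫ (u m : X m ⟶ X (m + 1)) := by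
  apply Sigma.hom_ext
  rintro ⟨n⟩
  rw [← Category.assoc, ι_hocPhi, Preadditive.sub_comp, Preadditive.comp_sub]
  congr 1
  rw [Category.assoc]
  by_cases h : n = m
  · subst h
    have h1 := Sigma.ι_π_eq_id (XU X) ⟨n + 1⟩
    have h2 := Sigma.ι_π_eq_id (XU X) ⟨n⟩
    rw [h1, reassoc_of% h2]
    exact Category.comp_id _
  · rw [Sigma.ι_π_of_ne (XU X) (b := ⟨n + 1⟩) (c := ⟨m + 1⟩) (by simpa using h),
      ← Category.assoc, Sigma.ι_π_of_ne (XU X) (b := ⟨n⟩) (c := ⟨m⟩) (by simpa using h)]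
    simp

lemma hocPhi_inj {C : T} (hC : IsCompactObj T C) (g : C ⟶ ∐ XU X) (hg : g ≫ hocPhi X u = 0) :
    g = 0 := by
  classical
  have key : ∀ n : ℕ, g ≫ Sigma.π (XU X) ⟨n⟩ = 0 := by
    intro n
    induction n with
    | zero =>
      rw [← hocPhi_π0 X u, ← Category.assoc, hg, zero_comp]
    | succ m ih =>
      have h1 := hocPhi_πS X u m
      have h2 := congrArg (fun z => g ≫ z) h1
      simp only [Preadditive.comp_sub] at h2
      rw [← Category.assoc, hg, zero_comp, ← Category.assoc, ih, zero_comp, sub_zero] at h2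
      exact h2.symm
  obtain ⟨s, hs⟩ := compact_FS hC (XU X) g
  rw [hs]
  refine Finset.sum_eq_zero fun j _ => ?_
  have h0 : g ≫ Sigma.π (XU X) j = 0 := key j.down
  rw [← Category.assoc]
  convert zero_comp
  convert h0
  
lemma hocPhi_inj1 {C : T} (hC : IsCompactObj T C) (g : C ⟶ (∐ XU X)⟦(1 : ℤ)⟧)
    (hg : g ≫ (hocPhi X u)⟦(1 : ℤ)⟧' = 0) : g = 0 := by
  let e := (shiftFunctorCompIsoId T (1 : ℤ) (-1) (by omega))
  have h1 := hocPhi_inj X u (compact_shift hC (-1)) (g⟦(-1 : ℤ)⟧' ≫ e.hom.app _) (by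
    rw [Category.assoc, ← Functor.id_map (hocPhi X u), ← e.hom.naturality, Functor.comp_map,
      ← Category.assoc, ← Functor.map_comp, hg]
    simp)
  apply (shiftFunctor T (-1 : ℤ)).map_injective
  rw [Functor.map_zero, ← cancel_mono (e.hom.app _)]
  rw [h1]; simp
end hocolim

variable (H) in
theorem brown {K : Type v} (G : K → T) (hG : ∀ k, IsCompactObj T (G k))
    (hgen : ∀ S : Set T, IsLocalizing T S → (∀ W, (∀ n : ℤ, ∃ k, Nonempty (W⟦n⟧ ≅ G k)) → W ∈ S) →
      ∀ W, W ∈ S)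
    (hsmall : ∀ k, Small.{v} (H.obj (G k))) :
    ∃ (X : T) (h : H.obj X), ∀ W, RepAt H h W := by
  -- start
  let J0 := Σ k : K, Shrink.{v} (H.obj (G k))
  let F0 : J0 → T := fun j => G j.1
  obtain ⟨h0, hh0⟩ := H.sigma J0 F0 fun j => (equivShrink _).symm j.2
  choose X' h' u' hu1 hu2 using fun (P : Σ X : T, H.obj X) => brown_step H G P.1 P.2
  let seq : ℕ → Σ X : T, H.obj X := fun n => Nat.rec ⟨∐ F0, h0⟩ (fun _ P => ⟨X' P, h' P⟩) n
  let X : ℕ → T := fun n => (seq n).1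
  let hx : ∀ n, H.obj (X n) := fun n => (seq n).2
  let u : ∀ n, X n ⟶ X (n + 1) := fun n => u' (seq n)
  have hu : ∀ n, H.map (u n) (hx (n + 1)) = hx n := fun n => hu1 (seq n)
  have hu0 : ∀ n k (f : G k ⟶ X n), H.map f (hx n) = 0 → f ≫ u n = 0 := fun n => hu2 (seq n)
  obtain ⟨Y, c, d, htri⟩ := distinguished_cocone_triangle (hocPhi X u)
  obtain ⟨y, hy⟩ := H.sigma (ULift.{v} ℕ) (XU X) fun j => hx j.down
  have hy0 : H.map (hocPhi X u) y = 0 := by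
    apply H.sigma_ext
    rintro ⟨n⟩
    rw [← H.map_comp, ι_hocPhi, H.map_sub, hy ⟨n⟩, H.map_comp, hy ⟨n + 1⟩]
    exact sub_eq_zero.2 (hu n).symm
  obtain ⟨h, hh'⟩ : ∃ h : H.obj Y, H.map c h = y := H.exact' _ htri y hy0
  let cn : ∀ n, X n ⟶ Y := fun n => Sigma.ι (XU X) ⟨n⟩ ≫ c
  have hcn : ∀ n, H.map (cn n) h = hx n := fun n => by
    rw [H.map_comp, hh']; exact hy ⟨n⟩
  have hcu : ∀ n, u n ≫ cn (n + 1) = cn n := fun n => by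
    have h1 : hocPhi X u ≫ c = 0 := comp_distTriang_mor_zero₁₂ _ htri
    have h2 := congrArg (fun z => Sigma.ι (XU X) ⟨n⟩ ≫ z) h1
    simp only [comp_zero] at h2
    rw [← Category.assoc, ι_hocPhi, Preadditive.sub_comp, sub_eq_zero, Category.assoc] at h2
    exact h2.symm
  have hfac : ∀ (C : T) (n : ℕ) (l : C ⟶ X n) (m : ℕ), ∃ l' : C ⟶ X (n + m),
      l ≫ cn n = l' ≫ cn (n + m) := by
    intro C n l m
    induction m with
    | zero => exact ⟨l, rfl⟩
    | succ m ih =>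
      obtain ⟨l', hl'⟩ := ih
      exact ⟨l' ≫ u (n + m), by rw [hl', Category.assoc]; congr 1; exact (hcu _).symm⟩
  have hfac' : ∀ (C : T) (n : ℕ) (l : C ⟶ X n) (m : ℕ), n ≤ m → ∃ l' : C ⟶ X m,
      l ≫ cn n = l' ≫ cn m := by
    intro C n l m hnm
    obtain ⟨k, rfl⟩ := Nat.exists_eq_add_of_le hnm
    exact hfac C n l k
  have hbase : ∀ k, RepAt H h (G k) := by
    intro k
    refine repAt_of (fun g hg => ?_) fun x => ?_
    · have hd : g ≫ d = 0 := hocPhi_inj1 X u (hG k) _ (by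
        rw [Category.assoc]
        have := comp_distTriang_mor_zero₃₁ _ htri
        have h2 : d ≫ (hocPhi X u)⟦(1 : ℤ)⟧' = 0 := this
        rw [h2, comp_zero])
      obtain ⟨l, hl'⟩ : ∃ l : G k ⟶ ∐ XU X, g = l ≫ c := Triangle.coyoneda_exact₃ _ htri g hd
      have : ∃ (N : ℕ) (l' : G k ⟶ X N), l ≫ c = l' ≫ cn N := by
        classical
        obtain ⟨s, hs⟩ := compact_FS (hG k) (XU X) l
        rw [hs]
        clear hs hl'
        induction s using Finset.induction_on with
        | empty => exact ⟨0, 0, by simp⟩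
        | insert a s ha ih =>
          rw [Finset.sum_insert ha, Preadditive.add_comp]
          obtain ⟨N, l', hl'⟩ := ih
          obtain ⟨m1, hm1⟩ := hfac' _ N l' (max N a.down) (le_max_left _ _)
          obtain ⟨m2, hm2⟩ := hfac' _ a.down (l ≫ Sigma.π (XU X) a) (max N a.down) (le_max_right _ _)
          refine ⟨max N a.down, m2 + m1, ?_⟩
          rw [Preadditive.add_comp, hl', ← hm1, ← hm2]
          congr 1
          simp only [cn, Category.assoc]
          congr!
      obtain ⟨N, l', hN⟩ := this
      rw [hl', hN] at hg ⊢
      rw [H.map_comp, hcn] at hg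
      rw [← hcu, ← Category.assoc, hu0 N k l' hg, zero_comp]
    · refine ⟨Sigma.ι F0 ⟨k, equivShrink _ x⟩ ≫ cn 0, ?_⟩
      rw [H.map_comp, hcn]
      have := hh0 ⟨k, equivShrink _ x⟩
      rw [Equiv.symm_apply_apply] at this
      exact this
  refine ⟨Y, h, fun W => ?_⟩
  have := hgen _ (repAt_loc h) (fun W hW n => by
    obtain ⟨k, ⟨e⟩⟩ := hW n
    exact (hbase k).iso e.symm) W
  exact (this 0).iso ((shiftFunctorZero T ℤ).app W)
end Brown
end BIKP

namespace BIKP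
open BIK
section Tors
variable {R : Type u} [Ring R] {𝒜 : ℤ → AddSubgroup R} [GradedRing 𝒜]
variable {T : Type u'} [Category.{v} T] [HasZeroObject T] [Preadditive T] [HasShift T ℤ]
  [∀ n : ℤ, (CategoryTheory.shiftFunctor T n).Additive] [Pretriangulated T]
  [HasCoproducts.{v} T] (A : CenterAction 𝒜 T)

/-- The morphism is killed by a homogeneous element outside of `r`. -/
def Pk (r : SpecR 𝒜) {X W : T} (g : X ⟶ W) : Prop :=
  ∃ (i : ℤ) (s : R) (hs : s ∈ 𝒜 i), s ∉ r.1.toIdeal ∧ g ≫ A.act i s hs W = 0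

variable {A} {r : SpecR 𝒜}

lemma Pk.pre {X X' W : T} {g : X ⟶ W} (h : Pk A r g) (u : X' ⟶ X) : Pk A r (u ≫ g) := by
  obtain ⟨i, s, hs, hr, h⟩ := h
  exact ⟨i, s, hs, hr, by rw [Category.assoc, h, comp_zero]⟩

lemma Pk.post {X W' W : T} {g : X ⟶ W} (h : Pk A r g) (u : W ⟶ W') : Pk A r (g ≫ u) := by
  obtain ⟨i, s, hs, hr, h⟩ := h
  exact ⟨i, s, hs, hr, by
    rw [Category.assoc, A.act_natural, ← Category.assoc, h, zero_comp]⟩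

lemma Pk.zero {X W : T} : Pk A r (0 : X ⟶ W) :=
  ⟨0, 1, SetLike.one_mem_graded 𝒜, fun h => r.2.ne_top ((Ideal.eq_top_iff_one _).2 h), zero_comp⟩

lemma spec_mul {i j : ℤ} {a b : R} (ha : a ∈ 𝒜 i) (hb : b ∈ 𝒜 j) (h1 : a ∉ r.1.toIdeal)
    (h2 : b ∉ r.1.toIdeal) : a * b ∉ r.1.toIdeal :=
  fun h => (r.2.mem_or_mem ha hb h).elim h1 h2

lemma Pk.of_act {X W : T} {g : X ⟶ W} {j : ℤ} {t : R} {ht : t ∈ 𝒜 j} (htr : t ∉ r.1.toIdeal)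
    (h : Pk A r (g ≫ A.act j t ht W)) : Pk A r g := by
  obtain ⟨i, s, hs, hr, h⟩ := h
  refine ⟨i + j, s * t, SetLike.mul_mem_graded hs ht, spec_mul hs ht hr htr, ?_⟩
  rw [Category.assoc] at h
  rw [A.act_mul i j s t hs ht, reassoc_of% h, zero_comp]

lemma Pk.add {X W : T} {f g : X ⟶ W} (hf : Pk A r f) (hg : Pk A r g) : Pk A r (f + g) := by
  obtain ⟨i, s, hs, hr, h⟩ := hf
  obtain ⟨j, t, ht, hr', h'⟩ := hg
  refine ⟨i + j, s * t, SetLike.mul_mem_graded hs ht, spec_mul hs ht hr hr', ?_⟩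
  rw [A.act_mul i j s t hs ht, Preadditive.add_comp, reassoc_of% h',
    ← Category.assoc (A.act j t ht W), A.act_natural, Category.assoc, reassoc_of% h]
  simp

lemma Pk.sum {X W : T} {K : Type*} (s : Finset K) (g : K → (X ⟶ W))
    (h : ∀ k ∈ s, Pk A r (g k)) : Pk A r (∑ k ∈ s, g k) := by
  classical
  induction s using Finset.induction_on with
  | empty => simpa using Pk.zero
  | insert a s ha ih =>
    rw [Finset.sum_insert ha]
    exact (h a (by simp)).add (ih fun k hk => h k (by simp [hk]))

lemma Pk.shift {X W : T} {g : X ⟶ W} (h : Pk A r g) (n : ℤ) : Pk A r (g⟦n⟧') := by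
  obtain ⟨i, s, hs, hr, h⟩ := h
  refine ⟨i, s, hs, hr, ?_⟩
  rw [A.act_shift, Preadditive.comp_zsmul, ← Category.assoc, ← Functor.map_comp, h]
  simp

lemma Pk.of_shift {X W : T} {g : X ⟶ W} (n : ℤ) (h : Pk A r (g⟦n⟧')) : Pk A r g := by
  have h1 := h.shift (-n)
  let e := shiftFunctorCompIsoId T n (-n) (by omega)
  have : g = e.inv.app X ≫ (g⟦n⟧')⟦-n⟧' ≫ e.hom.app W := by
    have := e.hom.naturality g
    simp only [Functor.comp_map, Functor.id_map] at this
    rw [this]; simp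
  rw [this]
  exact (h1.post _).pre _

lemma hsmul_zero_iff {i : ℤ} {a : R} (ha : a ∈ 𝒜 i) {X Y : T} {n : ℤ} (f : X ⟶ Y⟦n⟧) :
    A.hsmul ha f = 0 ↔ f ≫ A.act i a ha (Y⟦n⟧) = 0 := by
  unfold CenterAction.hsmul
  rw [← Category.assoc]
  constructor
  · intro h
    rw [← cancel_mono ((shiftFunctorAdd' T n i (n + i) rfl).inv.app Y), h]; simp
  · intro h; rw [h, zero_comp]

lemma mem_TV_iff' {V : Set (SpecR 𝒜)} {X : T} : X ∈ TVset T A V ↔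
    ∀ C : T, IsCompactObj T C → ∀ r : SpecR 𝒜, r ∉ V → ∀ (n : ℤ) (f : C ⟶ X⟦n⟧), Pk A r f := by
  simp only [TVset, LocVanishes, Set.mem_setOf_eq, hsmul_zero_iff, Pk]

lemma mem_TV_iff {V : Set (SpecR 𝒜)} {X : T} : X ∈ TVset T A V ↔
    ∀ C : T, IsCompactObj T C → ∀ r : SpecR 𝒜, r ∉ V → ∀ (f : C ⟶ X), Pk A r f := by
  rw [mem_TV_iff']
  constructor
  · intro h C hC r hr f
    have := (h C hC r hr 0 (f ≫ (shiftFunctorZero T ℤ).inv.app X)).post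
      ((shiftFunctorZero T ℤ).hom.app X)
    simpa using this
  · intro h C hC r hr n f
    apply Pk.of_shift (-n)
    have := (h _ (compact_shift hC (-n)) r hr
      (f⟦-n⟧' ≫ (shiftFunctorCompIsoId T n (-n) (by omega)).hom.app X)).post
      ((shiftFunctorCompIsoId T n (-n) (by omega)).inv.app X)
    simpa using this

lemma TV_mono {V V' : Set (SpecR 𝒜)} (h : V ⊆ V') : TVset T A V ⊆ TVset T A V' := by
  intro X hX
  rw [mem_TV_iff] at hX ⊢
  exact fun C hC r hr f => hX C hC r (fun hr' => hr (h hr')) f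

lemma TV_loc (V : Set (SpecR 𝒜)) : IsLocalizing T (TVset T A V) where
  zero_mem X hX := mem_TV_iff.2 fun C hC r hr f => by
    rw [hX.eq_of_tgt f 0]; exact Pk.zero
  iso_mem {X Y} e h := by
    rw [mem_TV_iff] at h ⊢
    intro C hC r hr f
    have := (h C hC r hr (f ≫ e.inv)).post e.hom
    simpa using this
  shift_mem X h n := by
    rw [mem_TV_iff'] at h
    rw [mem_TV_iff]
    exact fun C hC r hr f => h C hC r hr n f
  ext_mem Tr hTr h1 h2 := by
    rw [mem_TV_iff'] at h1 h2
    rw [mem_TV_iff]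
    intro C hC r hr f
    obtain ⟨i, s, hs, hsr, h⟩ := h1 C hC r hr 1 (f ≫ Tr.mor₃)
    obtain ⟨l, hl⟩ := coyoneda_exact₃_shift Tr hTr i (f ≫ A.act i s hs Tr.obj₃) (by
      rw [Category.assoc, ← A.act_natural, ← Category.assoc, h])
    apply Pk.of_act (ht := hs) hsr
    rw [hl]
    exact (h2 C hC r hr i l).post _
  coprod_mem J F hF := by
    rw [mem_TV_iff]
    intro C hC r hr f
    obtain ⟨s, hs⟩ := compact_FS hC F f
    rw [hs]
    refine Pk.sum _ _ fun j _ => ?_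
    rw [← Category.assoc]
    exact (mem_TV_iff.1 (hF j) C hC r hr _).post _

lemma Zset_closed (p : SpecR 𝒜) : SpecClosed (Zset p) := fun a b ha hab hb => ha (hab.trans hb)

lemma Vp_closed (p : SpecR 𝒜) : SpecClosed (Vp p) := fun a b ha hab => le_trans ha hab

lemma TV_Vp_Zq {p q : SpecR 𝒜} (h : ¬ p.1.toIdeal ≤ q.1.toIdeal) :
    TVset T A (Vp p) ⊆ TVset T A (Zset q) :=
  TV_mono fun r hr hrq => h (le_trans hr hrq)

lemma TV_Zp_Zq {p q : SpecR 𝒜} (h : q.1.toIdeal ≤ p.1.toIdeal) :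
    TVset T A (Zset p) ⊆ TVset T A (Zset q) :=
  TV_mono fun r hr hrq => hr (hrq.trans h)

lemma TV_Vp_Vq {p q : SpecR 𝒜} (h : p.1.toIdeal ≤ q.1.toIdeal) :
    TVset T A (Vp q) ⊆ TVset T A (Vp p) :=
  TV_mono fun r hr => h.trans hr

/-- not in `T_{Z(p)}` -/
lemma notMem_TVZ {p : SpecR 𝒜} {X : T} (h : X ∉ TVset T A (Zset p)) :
    ∃ (C : T) (f : C ⟶ X), IsCompactObj T C ∧ ¬ Pk A p f := by
  rw [mem_TV_iff] at h
  push Not at h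
  obtain ⟨C, hC, r, hr, f, hf⟩ := h
  refine ⟨C, f, hC, fun h => hf ?_⟩
  obtain ⟨i, s, hs, hsp, h⟩ := h
  exact ⟨i, s, hs, fun h' => hsp ((not_not.1 hr) h'), h⟩

/-! ### localization functors -/
variable (B : BIKData A)

lemma L_idem_zero {V : Set (SpecR 𝒜)} (hV : SpecClosed V) {W X : T} (hW : W ∈ TVset T A V)
    (f : W ⟶ (B.Lf V).obj X) : f = 0 := by
  have h1 : f ≫ (B.η V).app ((B.Lf V).obj X) = (B.η V).app W ≫ (B.Lf V).map f :=
    (B.η V).naturality f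
  rw [((B.kerL V hV W).2 hW).eq_of_tgt ((B.η V).app W) 0, zero_comp, ← B.Lη_eq V hV] at h1
  have := B.Lη_iso V hV X
  rw [← cancel_mono ((B.Lf V).map ((B.η V).app X)), h1, zero_comp]

open ZeroObject in
lemma L_map_zero {V : Set (SpecR 𝒜)} (hV : SpecClosed V) (X Y : T) :
    (B.Lf V).map (0 : X ⟶ Y) = 0 := by
  have hz : IsZero ((B.Lf V).obj (0 : T)) :=
    (B.kerL V hV _).2 ((TV_loc V).zero_mem _ (isZero_zero T))
  have : (0 : X ⟶ Y) = (0 : X ⟶ (0 : T)) ≫ (0 : (0 : T) ⟶ Y) := by simp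
  rw [this, Functor.map_comp, hz.eq_of_tgt ((B.Lf V).map (0 : X ⟶ (0 : T))) 0, zero_comp]

lemma isZero_of_tri (Tr : Triangle T) (hTr : Tr ∈ distTriang T) (h2 : IsZero Tr.obj₂)
    (h3 : IsZero Tr.obj₃) : IsZero Tr.obj₁ := by
  have hl : IsLocalizing T {X : T | IsZero X} := by
    refine ⟨fun X h => h, fun e h => h.of_iso e.symm, fun X h n => (shiftFunctor T n).map_isZero h,
      fun Tr hTr h1 h2 => ?_, fun J f hf => ?_⟩
    · exact Triangle.isZero₃_of_isZero₁₂ Tr hTr h1 h2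
    · rw [Set.mem_setOf_eq, IsZero.iff_id_eq_zero]
      ext j
      exact (hf j).eq_of_src _ _
  exact IsLocalizing.obj1 hl Tr hTr h2 h3

lemma isZero_loc : IsLocalizing T {X : T | IsZero X} := by
  refine ⟨fun X h => h, fun e h => h.of_iso e.symm, fun X h n => (shiftFunctor T n).map_isZero h,
    fun Tr hTr h1 h2 => ?_, fun J f hf => ?_⟩
  · exact Triangle.isZero₃_of_isZero₁₂ Tr hTr h1 h2
  · rw [Set.mem_setOf_eq, IsZero.iff_id_eq_zero]
    ext j
    exact (hf j).eq_of_src _ _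

/-- objects of `T_{Z(p)}` have vanishing `Γ_p`. -/
lemma ΓP_zero_of_mem {p : SpecR 𝒜} {X : T} (hX : X ∈ TVset T A (Zset p)) :
    IsZero ((B.ΓP p).obj X) := by
  have h1 : IsZero ((B.Lf (Zset p)).obj X) := (B.kerL _ (Zset_closed p) X).2 hX
  have h2 : IsZero ((B.Lf (Vp p)).obj ((B.Lf (Zset p)).obj X)) :=
    (B.kerL _ (Vp_closed p) _).2 ((TV_loc _).zero_mem _ h1)
  exact isZero_of_tri _ (B.tri _ (Vp_closed p) ((B.Lf (Zset p)).obj X)) h1 h2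

lemma ΓP_ne_zero {p : SpecR 𝒜} {X : T} (h1 : X ∈ TVset T A (Vp p))
    (h2 : X ∉ TVset T A (Zset p)) : ¬ IsZero ((B.ΓP p).obj X) := by
  intro hz
  apply h2
  let W := (B.Lf (Zset p)).obj X
  have htri := B.tri _ (Vp_closed p) W
  have hz' : IsZero ((B.Γ (Vp p)).obj W) := hz
  have h3 : (B.η (Zset p)).app X ≫ (B.η (Vp p)).app W = 0 := L_idem_zero B (Vp_closed p) h1 _
  obtain ⟨k, hk⟩ : ∃ k : X ⟶ (B.Γ (Vp p)).obj W, (B.η (Zset p)).app X = k ≫ (B.γ (Vp p)).app W :=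
    Triangle.coyoneda_exact₂ _ htri ((B.η (Zset p)).app X) h3
  rw [hz'.eq_of_tgt k 0, zero_comp] at hk
  have h4 := B.Lη_iso _ (Zset_closed p) X
  rw [← B.kerL _ (Zset_closed p)]
  have h5 : (B.Lf (Zset p)).map ((B.η (Zset p)).app X) = 0 := by
    rw [hk]; exact L_map_zero B (Zset_closed p) _ _
  rw [IsZero.iff_id_eq_zero]
  rw [← cancel_mono ((B.Lf (Zset p)).map ((B.η (Zset p)).app X)), h5]
  simp

lemma image_zero_of_mem {p : SpecR 𝒜} {Z : T} (hZ : Z ∈ B.ΓPImage p) (h1 : Z ∈ TVset T A (Vp p))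
    (h2 : Z ∈ TVset T A (Zset p)) : IsZero Z := by
  obtain ⟨Y, ⟨e⟩⟩ := hZ
  let W := (B.Lf (Zset p)).obj Y
  let G := (B.Γ (Vp p)).obj W
  have e' : Z ≅ G := e
  have g1 : G ∈ TVset T A (Vp p) := (TV_loc _).iso_mem e' h1
  have g2 : G ∈ TVset T A (Zset p) := (TV_loc _).iso_mem e' h2
  have htri := B.tri _ (Vp_closed p) W
  have h3 : (B.γ (Vp p)).app W = 0 := L_idem_zero B (Zset_closed p) g2 _
  have hrot := rot_of_distTriang _ (rot_of_distTriang _ htri)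
  obtain ⟨k, hk⟩ : ∃ k : G⟦(1 : ℤ)⟧ ⟶ (B.Lf (Vp p)).obj W, 𝟙 (G⟦(1 : ℤ)⟧) = k ≫ B.δ (Vp p) W :=
    Triangle.coyoneda_exact₂ _ (rot_of_distTriang _ (rot_of_distTriang _ htri)) (𝟙 (G⟦(1 : ℤ)⟧)) (by
      show 𝟙 (G⟦(1 : ℤ)⟧) ≫ (-((B.γ (Vp p)).app W)⟦(1 : ℤ)⟧') = 0
      rw [h3]; simp)
  rw [L_idem_zero B (Vp_closed p) ((TV_loc _).shift_mem _ g1 1) k, zero_comp] at hk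
  have h5 : IsZero (G⟦(1 : ℤ)⟧) := (IsZero.iff_id_eq_zero _).2 hk
  have h6 : IsZero G := (isZero_loc (T := T)).iso_mem
    ((shiftFunctorCompIsoId T (1 : ℤ) (-1) (by omega)).app G)
    ((isZero_loc (T := T)).shift_mem _ h5 (-1))
  exact h6.of_iso e'

lemma image_sub_Loc (hst : Stratified B) {p : SpecR 𝒜} {Z : T} (hZ : Z ∈ B.ΓPImage p)
    (h0 : ¬ IsZero Z) : B.ΓPImage p ⊆ Loc T {Z} := by
  rcases hst.2 p with h | h
  · exact absurd (h Z hZ) h0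
  · have h1 : Loc T {Z} ⊆ B.ΓPImage p := Loc_le h.1 (by simpa using hZ)
    rcases h.2.2 _ (Loc_isLoc _) h1 with h2 | h2
    · exact absurd (h2 Z (subset_Loc _ rfl)) h0
    · rw [h2]

lemma ΓP_mem_Loc (hst : Stratified B) (p : SpecR 𝒜) (X : T) : (B.ΓP p).obj X ∈ Loc T {X} := by
  rw [hst.1 X]; exact subset_Loc _ ⟨p, rfl⟩

lemma ΓP_mem_image (p : SpecR 𝒜) (X : T) : (B.ΓP p).obj X ∈ B.ΓPImage p := ⟨X, ⟨Iso.refl _⟩⟩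

lemma mem_of_ΓP (hst : Stratified B) {S : Set T} (hS : IsLocalizing T S) {X : T}
    (h : ∀ p, (B.ΓP p).obj X ∈ S) : X ∈ S := by
  have : X ∈ Loc T {X} := subset_Loc _ rfl
  rw [hst.1 X] at this
  exact Loc_le hS (by rintro _ ⟨p, rfl⟩; exact h p) this
end Tors
end BIKP

namespace BIKP
open BIK
section GrMod
variable {R : Type u} [Ring R] {𝒜 : ℤ → AddSubgroup R} [GradedRing 𝒜]
variable {T : Type u'} [Category.{v} T] [HasZeroObject T] [Preadditive T] [HasShift T ℤ]
  [∀ n : ℤ, (CategoryTheory.shiftFunctor T n).Additive] [Pretriangulated T]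
  [HasCoproducts.{v} T] (A : CenterAction 𝒜 T)

/-- the action with flexible target degree -/
def hs {i : ℤ} {a : R} (ha : a ∈ 𝒜 i) {C W : T} {n m : ℤ} (h : n + i = m) (f : C ⟶ W⟦n⟧) :
    C ⟶ W⟦m⟧ := f ≫ A.act i a ha (W⟦n⟧) ≫ (shiftFunctorAdd' T n i m h).inv.app W

lemma hs_hsmul {i : ℤ} {a : R} (ha : a ∈ 𝒜 i) {C W : T} {n : ℤ} (f : C ⟶ W⟦n⟧) :
    hs A ha rfl f = A.hsmul ha f := rfl

lemma hs_add {i : ℤ} {a : R} (ha : a ∈ 𝒜 i) {C W : T} {n m : ℤ} (h : n + i = m) (f g : C ⟶ W⟦n⟧) :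
    hs A ha h (f + g) = hs A ha h f + hs A ha h g := by simp [hs]

lemma hs_add_left {i : ℤ} {a b : R} (ha : a ∈ 𝒜 i) (hb : b ∈ 𝒜 i) {C W : T} {n m : ℤ}
    (h : n + i = m) (f : C ⟶ W⟦n⟧) :
    hs A (add_mem ha hb) h f = hs A ha h f + hs A hb h f := by
  simp only [hs]
  rw [A.act_add i a b ha hb]
  simp

lemma hs_one {C W : T} {n : ℤ} (f : C ⟶ W⟦n⟧) :
    hs A (SetLike.one_mem_graded 𝒜) (add_zero n) f = f := by
  rw [hs, A.act_one, shiftFunctorAdd'_add_zero_inv_app]; simp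

lemma hs_mul {i j : ℤ} {a b : R} (ha : a ∈ 𝒜 i) (hb : b ∈ 𝒜 j) {C W : T} {n m k : ℤ}
    (h : n + j = m) (h' : m + i = k) (f : C ⟶ W⟦n⟧) :
    hs A (SetLike.mul_mem_graded ha hb) (by omega : n + (i + j) = k) f = hs A ha h' (hs A hb h f) := by
  simp only [hs, Category.assoc, A.act_mul i j a b ha hb]
  rw [← Category.assoc ((shiftFunctorAdd' T n j m h).inv.app W), A.act_natural]
  simp only [Category.assoc]
  rw [shiftFunctorAdd'_assoc_inv_app n j i m (i + j) k h (by ring) (by omega) W]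
  rfl

lemma hs_post {i : ℤ} {a : R} (ha : a ∈ 𝒜 i) {C W W' : T} (v : W ⟶ W') {n m : ℤ} (h : n + i = m)
    (f : C ⟶ W⟦n⟧) : hs A ha h (f ≫ v⟦n⟧') = hs A ha h f ≫ v⟦m⟧' := by
  simp only [hs, Category.assoc]
  rw [← Category.assoc (v⟦n⟧'), A.act_natural, Category.assoc]
  have := (shiftFunctorAdd' T n i m h).inv.naturality v
  simp only [Functor.comp_map] at this
  rw [this]

lemma hs_pre {i : ℤ} {a : R} (ha : a ∈ 𝒜 i) {C C' W : T} (v : C' ⟶ C) {n m : ℤ} (h : n + i = m)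
    (f : C ⟶ W⟦n⟧) : hs A ha h (v ≫ f) = v ≫ hs A ha h f := by simp [hs]

/-- the graded module `Hom*(C,W)`. -/
def MM (A : CenterAction 𝒜 T) (C W : T) : Type v := DirectSum ℤ (fun n => C ⟶ W⟦n⟧)

noncomputable instance (C W : T) : AddCommGroup (MM A C W) :=
  inferInstanceAs (AddCommGroup (DirectSum ℤ (fun n => C ⟶ W⟦n⟧)))

/-- inclusion of a homogeneous component -/
noncomputable def mι {C W : T} (n : ℤ) : (C ⟶ W⟦n⟧) →+ MM A C W :=
  DirectSum.of (fun n => C ⟶ W⟦n⟧) n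

/-- projection to a homogeneous component -/
noncomputable def mπ {C W : T} (n : ℤ) : MM A C W →+ (C ⟶ W⟦n⟧) :=
  { toFun := fun x => (show DirectSum ℤ (fun n => C ⟶ W⟦n⟧) from x) n
    map_zero' := rfl
    map_add' := fun _ _ => rfl }

variable {A}
lemma mπ_mι {C W : T} (n : ℤ) (f : C ⟶ W⟦n⟧) : mπ A n (mι A n f) = f :=
  DirectSum.of_eq_same _ _

lemma mπ_mι_ne {C W : T} {n m : ℤ} (h : n ≠ m) (f : C ⟶ W⟦n⟧) : mπ A m (mι A n f) = 0 :=
  DirectSum.of_eq_of_ne _ _ _ (Ne.symm h)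

lemma MM_ext {C W : T} {x y : MM A C W} (h : ∀ n, mπ A n x = mπ A n y) : x = y :=
  DFinsupp.ext h

lemma MM_ind {C W : T} {P : MM A C W → Prop} (x : MM A C W) (h0 : P 0)
    (h1 : ∀ n f, P (mι A n f)) (h2 : ∀ x y, P x → P y → P (x + y)) : P x :=
  DirectSum.induction_on x h0 h1 h2

/-- morphisms out of the direct sum -/
noncomputable def mlift {C W : T} {N : Type*} [AddCommMonoid N] (φ : ∀ n : ℤ, (C ⟶ W⟦n⟧) →+ N) :
    MM A C W →+ N := DirectSum.toAddMonoid φ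

lemma mlift_mι {C W : T} {N : Type*} [AddCommMonoid N] (φ : ∀ n : ℤ, (C ⟶ W⟦n⟧) →+ N) (n : ℤ)
    (f : C ⟶ W⟦n⟧) : mlift φ (mι A n f) = φ n f := DirectSum.toAddMonoid_of _ _ _

lemma mhom_ext {C W : T} {N : Type*} [AddCommMonoid N] {φ ψ : MM A C W →+ N}
    (h : ∀ n f, φ (mι A n f) = ψ (mι A n f)) : φ = ψ := by
  ext x
  induction x using MM_ind with
  | h0 => simp
  | h1 n f => exact h n f
  | h2 x y hx hy => rw [map_add, map_add, hx, hy]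

lemma mι_hs {i i' : ℤ} {a : R} (ha : a ∈ 𝒜 i) (ha' : a ∈ 𝒜 i') (hi : i = i') {C W : T} {n m m' : ℤ}
    (h : n + i = m) (h' : n + i' = m') (f : C ⟶ W⟦n⟧) :
    mι A m (hs A ha h f) = mι A m' (hs A ha' h' f) := by
  subst hi; subst h; subst h'; rfl

variable (A) in
/-- multiplication by a homogeneous element, unbundled -/
noncomputable def mulF (C W : T) (i : ℤ) (a : 𝒜 i) : MM A C W →+ MM A C W :=
  mlift fun n => (mι A (n + i)).comp
    (AddMonoidHom.mk' (fun f => hs A a.2 rfl f) (fun f g => hs_add A a.2 rfl f g))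

lemma mulF_mι {C W : T} {i : ℤ} (a : 𝒜 i) {n m : ℤ} (h : n + i = m) (f : C ⟶ W⟦n⟧) :
    mulF A C W i a (mι A n f) = mι A m (hs A a.2 h f) := by
  subst h
  rw [mulF, mlift_mι]
  rfl

lemma mulF_add {C W : T} {i : ℤ} (a b : 𝒜 i) (x : MM A C W) :
    mulF A C W i (a + b) x = mulF A C W i a x + mulF A C W i b x := by
  induction x using MM_ind with
  | h0 => simp
  | h1 n f =>
    rw [mulF_mι _ rfl, mulF_mι _ rfl, mulF_mι _ rfl, ← map_add]
    congr 1
    exact hs_add_left A a.2 b.2 rfl f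
  | h2 x y hx hy => rw [map_add, hx, hy, map_add, map_add]; abel

variable (A) in
/-- multiplication by a homogeneous element -/
noncomputable def mulE (C W : T) (i : ℤ) : 𝒜 i →+ AddMonoid.End (MM A C W) :=
  AddMonoidHom.mk' (fun a => mulF A C W i a)
    (fun a b => DFunLike.ext _ _ fun x => mulF_add a b x)

lemma mulE_mι {C W : T} {i : ℤ} (a : 𝒜 i) {n m : ℤ} (h : n + i = m) (f : C ⟶ W⟦n⟧) :
    mulE A C W i a (mι A n f) = mι A m (hs A a.2 h f) := mulF_mι a h f

variable (A) in
/-- the additive map underlying the module structure -/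
noncomputable def smulA (C W : T) : R →+ AddMonoid.End (MM A C W) :=
  (DirectSum.toAddMonoid (mulE A C W)).comp (DirectSum.decomposeAddEquiv 𝒜).toAddMonoidHom

lemma smulA_hom {C W : T} {i : ℤ} {a : R} (ha : a ∈ 𝒜 i) : smulA A C W a = mulE A C W i ⟨a, ha⟩ := by
  have : DirectSum.decomposeAddEquiv 𝒜 a = DirectSum.of (fun i => 𝒜 i) i ⟨a, ha⟩ :=
    DirectSum.decompose_of_mem 𝒜 ha
  show DirectSum.toAddMonoid (mulE A C W) (DirectSum.decomposeAddEquiv 𝒜 a) = _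
  rw [this, DirectSum.toAddMonoid_of]

lemma smulA_mι {C W : T} {i : ℤ} {a : R} (ha : a ∈ 𝒜 i) {n m : ℤ} (h : n + i = m) (f : C ⟶ W⟦n⟧) :
    smulA A C W a (mι A n f) = mι A m (hs A ha h f) := by
  rw [smulA_hom ha, mulE_mι _ h]

lemma smulA_one {C W : T} (x : MM A C W) : smulA A C W 1 x = x := by
  induction x using MM_ind with
  | h0 => exact map_zero _
  | h1 n f => rw [smulA_mι (SetLike.one_mem_graded 𝒜) (add_zero n), hs_one]
  | h2 x y hx hy => rw [map_add, hx, hy]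

lemma smulA_add {C W : T} (a b : R) (x : MM A C W) :
    smulA A C W (a + b) x = smulA A C W a x + smulA A C W b x := by
  rw [map_add]; rfl

lemma smulA_zero {C W : T} (x : MM A C W) :
    smulA A C W 0 x = 0 := by
  rw [map_zero]; rfl

lemma smulA_mul {C W : T} (a b : R) (x : MM A C W) :
    smulA A C W (a * b) x = smulA A C W a (smulA A C W b x) := by
  induction a using DirectSum.Decomposition.inductionOn 𝒜 with
  | zero => rw [zero_mul, smulA_zero, smulA_zero]
  | add a a' h h' => rw [add_mul, smulA_add, h, h', smulA_add]
  | @homogeneous i a =>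
    induction b using DirectSum.Decomposition.inductionOn 𝒜 with
    | zero => rw [mul_zero, smulA_zero, map_zero]
    | add b b' h h' => rw [mul_add, smulA_add, h, h', smulA_add, map_add]
    | @homogeneous j b =>
      induction x using MM_ind with
      | h0 => rw [map_zero, map_zero, map_zero]
      | h2 x y hx hy => rw [map_add, hx, hy, map_add, map_add]
      | h1 n f =>
        rw [smulA_mι b.2 rfl, smulA_mι a.2 rfl,
          smulA_mι (SetLike.mul_mem_graded a.2 b.2) (by omega : n + (i + j) = n + j + i)]
        rw [hs_mul A a.2 b.2 rfl rfl f]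

variable (A) in
/-- the ring homomorphism underlying the module structure -/
noncomputable def smulR (C W : T) : R →+* AddMonoid.End (MM A C W) :=
  { smulA A C W with
    map_one' := DFunLike.ext _ _ fun x => smulA_one x
    map_mul' := fun a b => DFunLike.ext _ _ fun x => smulA_mul a b x }

noncomputable instance (C W : T) : Module R (MM A C W) := Module.compHom _ (smulR A C W)

lemma smul_mι {C W : T} {i : ℤ} {a : R} (ha : a ∈ 𝒜 i) {n m : ℤ} (h : n + i = m) (f : C ⟶ W⟦n⟧) :
    a • mι A n f = mι A m (hs A ha h f) := smulA_mι ha h f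

lemma smul_mι_zero {C W : T} {i : ℤ} {a : R} (ha : a ∈ 𝒜 i) {n : ℤ} (f : C ⟶ W⟦n⟧) :
    a • mι A n f = 0 ↔ f ≫ A.act i a ha (W⟦n⟧) = 0 := by
  rw [smul_mι ha rfl, ← hsmul_zero_iff, ← hs_hsmul]
  constructor
  · intro h
    have := congrArg (mπ A (n + i)) h
    rwa [mπ_mι, map_zero] at this
  · intro h; rw [h, map_zero]

variable (A) in
/-- postcomposition, additive version -/
noncomputable def postA (C : T) {W W' : T} (v : W ⟶ W') : MM A C W →+ MM A C W' :=
  mlift fun n => (mι A n).comp (AddMonoidHom.mk' (fun f => f ≫ v⟦n⟧') (fun f g => by simp))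

lemma postA_mι {C W W' : T} (v : W ⟶ W') (n : ℤ) (f : C ⟶ W⟦n⟧) :
    postA A C v (mι A n f) = mι A n (f ≫ v⟦n⟧') := by
  rw [postA, mlift_mι]
  rfl

lemma postA_smul {C W W' : T} (v : W ⟶ W') (a : R) (x : MM A C W) :
    postA A C v (a • x) = a • postA A C v x := by
  induction a using DirectSum.Decomposition.inductionOn 𝒜 with
  | zero => simp
  | add a a' h h' => rw [add_smul, map_add, h, h', add_smul]
  | @homogeneous i a =>
    induction x using MM_ind with
    | h0 => simp
    | h2 x y h h' => rw [smul_add, map_add, h, h', map_add, smul_add]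
    | h1 n f => rw [smul_mι a.2 rfl, postA_mι, postA_mι, smul_mι a.2 rfl, hs_post]

variable (A) in
/-- postcomposition -/
noncomputable def post (C : T) {W W' : T} (v : W ⟶ W') : MM A C W →ₗ[R] MM A C W' :=
  { postA A C v with map_smul' := fun a x => postA_smul v a x }

lemma post_mι {C W W' : T} (v : W ⟶ W') (n : ℤ) (f : C ⟶ W⟦n⟧) :
    post A C v (mι A n f) = mι A n (f ≫ v⟦n⟧') := postA_mι v n f

variable (A) in
/-- precomposition, additive version -/
noncomputable def precA {C C' : T} (v : C' ⟶ C) (W : T) : MM A C W →+ MM A C' W :=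
  mlift fun n => (mι A n).comp (AddMonoidHom.mk' (fun f => v ≫ f) (fun f g => by simp))

lemma precA_mι {C C' : T} (v : C' ⟶ C) {W : T} (n : ℤ) (f : C ⟶ W⟦n⟧) :
    precA A v W (mι A n f) = mι A n (v ≫ f) := by
  rw [precA, mlift_mι]
  rfl

lemma precA_smul {C C' : T} (v : C' ⟶ C) {W : T} (a : R) (x : MM A C W) :
    precA A v W (a • x) = a • precA A v W x := by
  induction a using DirectSum.Decomposition.inductionOn 𝒜 with
  | zero => simp
  | add a a' h h' => rw [add_smul, map_add, h, h', add_smul]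
  | @homogeneous i a =>
    induction x using MM_ind with
    | h0 => simp
    | h2 x y h h' => rw [smul_add, map_add, h, h', map_add, smul_add]
    | h1 n f => rw [smul_mι a.2 rfl, precA_mι, precA_mι, smul_mι a.2 rfl, hs_pre]

variable (A) in
/-- precomposition -/
noncomputable def prec {C C' : T} (v : C' ⟶ C) (W : T) : MM A C W →ₗ[R] MM A C' W :=
  { precA A v W with map_smul' := fun a x => precA_smul v a x }

lemma prec_mι {C C' : T} (v : C' ⟶ C) {W : T} (n : ℤ) (f : C ⟶ W⟦n⟧) :
    prec A v W (mι A n f) = mι A n (v ≫ f) := precA_mι v n f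

lemma lin_ext {C W : T} {N : Type*} [AddCommMonoid N] [Module R N] {φ ψ : MM A C W →ₗ[R] N}
    (h : ∀ n f, φ (mι A n f) = ψ (mι A n f)) : φ = ψ := by
  have := mhom_ext (φ := φ.toAddMonoidHom) (ψ := ψ.toAddMonoidHom) h
  ext x; exact DFunLike.congr_fun this x

lemma post_id (C W : T) (x : MM A C W) : post A C (𝟙 W) x = x := by
  induction x using MM_ind with
  | h0 => simp
  | h1 n f => rw [post_mι]; simp
  | h2 x y h h' => rw [map_add, h, h']

lemma post_comp (C : T) {W W' W'' : T} (f : W ⟶ W') (g : W' ⟶ W'') (x : MM A C W) :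
    post A C (f ≫ g) x = post A C g (post A C f x) := by
  induction x using MM_ind with
  | h0 => simp
  | h1 n f => simp [post_mι]
  | h2 x y h h' => rw [map_add, h, h', map_add, map_add]

lemma post_add (C : T) {W W' : T} (f g : W ⟶ W') (x : MM A C W) :
    post A C (f + g) x = post A C f x + post A C g x := by
  induction x using MM_ind with
  | h0 => simp
  | h1 n f => simp [post_mι, Functor.map_add]
  | h2 x y h h' => rw [map_add, h, h', map_add, map_add]; abel

lemma post_exact (C : T) (Tr : Triangle T) (hTr : Tr ∈ distTriang T) (y : MM A C Tr.obj₂)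
    (hy : post A C Tr.mor₂ y = 0) : ∃ x, post A C Tr.mor₁ x = y := by
  classical
  have h1 : ∀ n, ∃ l : C ⟶ Tr.obj₁⟦n⟧, mπ A n y = l ≫ Tr.mor₁⟦n⟧' := by
    intro n
    apply coyoneda_exact₂_shift Tr hTr
    have h2 : ∀ y : MM A C Tr.obj₂, mπ A n (post A C Tr.mor₂ y) = mπ A n y ≫ Tr.mor₂⟦n⟧' := by
      intro y
      induction y using MM_ind with
      | h0 => simp
      | h1 m f =>
        rw [post_mι]
        by_cases h : m = n
        · subst h; rw [mπ_mι, mπ_mι]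
        · rw [mπ_mι_ne h, mπ_mι_ne h, zero_comp]
      | h2 x y h h' => rw [map_add, map_add, h, h', map_add, Preadditive.add_comp]
    rw [← h2, hy, map_zero]
  choose l hl using h1
  have h3 : ∃ s : Finset ℤ, y = ∑ n ∈ s, mι A n (mπ A n y) :=
    ⟨_, (DirectSum.sum_support_of (β := fun n => C ⟶ Tr.obj₂⟦n⟧) y).symm⟩
  obtain ⟨s, hs⟩ := h3
  refine ⟨∑ n ∈ s, mι A n (l n), ?_⟩
  rw [map_sum]
  conv_rhs => rw [hs]
  refine Finset.sum_congr rfl fun n _ => ?_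
  rw [post_mι, ← hl]
end GrMod
end BIKP

namespace BIKP
open BIK
section Koszul
variable {R : Type u} [Ring R] {𝒜 : ℤ → AddSubgroup R} [GradedRing 𝒜]
variable {T : Type u'} [Category.{v} T] [HasZeroObject T] [Preadditive T] [HasShift T ℤ]
  [∀ n : ℤ, (CategoryTheory.shiftFunctor T n).Additive] [Pretriangulated T]
  [HasCoproducts.{v} T] {A : CenterAction 𝒜 T}

lemma fin_of_FG {C D : T} (h : FGHom A C D) : Module.Finite R (MM A C D) := by
  classical
  obtain ⟨F, hF⟩ := h
  let N : Submodule R (MM A C D) := Submodule.span R (F.image (fun g => mι A g.1 g.2))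
  let S : HomSub A C D :=
    { car := fun n => N.toAddSubgroup.comap (mι A n)
      hsmul_mem := fun i a ha n f hf => by
        have h1 : mι A n f ∈ N := hf
        have h2 := N.smul_mem a h1
        rw [smul_mι ha rfl] at h2
        exact h2 }
  have h1 := hF S (fun g hg => Submodule.subset_span (by
    rw [Finset.mem_coe]; exact Finset.mem_image_of_mem _ hg))
  refine ⟨⟨F.image (fun g => mι A g.1 g.2), ?_⟩⟩
  rw [eq_top_iff]
  intro x _
  induction x using MM_ind with
  | h0 => exact zero_mem _
  | h1 n f => exact h1 n f
  | h2 x y hx hy => exact add_mem (hx trivial) (hy trivial)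

lemma compact_biprod {C D : T} (hC : IsCompactObj T C) (hD : IsCompactObj T D) :
    IsCompactObj T (C ⊞ D) :=
  compact_cone _ (inv_rot_of_distTriang _ (binaryBiproductTriangle_distinguished C D))
    (compact_shift hD (-1)) hC

lemma fin_MM (hT : NoetherianT A) {C D : T} (hC : IsCompactObj T C) (hD : IsCompactObj T D) :
    Module.Finite R (MM A C D) := by
  have := fin_of_FG (hT _ (compact_biprod hC hD))
  refine Module.Finite.of_surjective ((prec A (biprod.inl : C ⟶ C ⊞ D) D).comp
    (post A (C ⊞ D) (biprod.snd : C ⊞ D ⟶ D))) ?_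
  intro x
  induction x using MM_ind with
  | h0 => exact ⟨0, map_zero _⟩
  | h1 n f =>
    refine ⟨mι A n (biprod.fst ≫ f ≫ (biprod.inr : D ⟶ C ⊞ D)⟦n⟧'), ?_⟩
    rw [LinearMap.comp_apply, post_mι, prec_mι]
    congr 1
    simp only [Category.assoc, ← Functor.map_comp, biprod.inr_snd]
    simp
  | h2 x y hx hy =>
    obtain ⟨a, ha⟩ := hx
    obtain ⟨b, hb⟩ := hy
    exact ⟨a + b, by rw [map_add, ha, hb]⟩

lemma fin_MM_even [Fact (IsGradedComm 𝒜)] [Fact (IsNoetherianRing R)] (hT : NoetherianT A) {C D : T}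
    (hC : IsCompactObj T C) (hD : IsCompactObj T D) :
    Module.Finite (evenSub 𝒜) (MM A C D) := by
  have := fin_MM hT hC hD
  have := finite_even_R 𝒜 Fact.out
  exact Module.Finite.trans R _

lemma comp_smul_zero {C W : T} {n : ℤ} (f : C ⟶ W⟦n⟧) (t : R) (h : t • mι A n f = 0) (k : ℤ) :
    ((DirectSum.decompose 𝒜 t k : 𝒜 k) : R) • mι A n f = 0 := by
  classical
  have key : ∀ t : R, mι A (n + k) (mπ A (n + k) (t • mι A n f)) =
      ((DirectSum.decompose 𝒜 t k : 𝒜 k) : R) • mι A n f := by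
    intro t
    induction t using DirectSum.Decomposition.inductionOn 𝒜 with
    | zero => simp
    | add a a' h h' => rw [add_smul, map_add, map_add, h, h', DirectSum.decompose_add,
        DirectSum.add_apply, AddSubgroup.coe_add, add_smul]
    | @homogeneous i a =>
      by_cases hik : i = k
      · subst hik
        rw [DirectSum.decompose_of_mem_same 𝒜 a.2, smul_mι a.2 rfl, mπ_mι]
      · rw [DirectSum.decompose_of_mem_ne 𝒜 a.2 hik, smul_mι a.2 rfl, mπ_mι_ne (by omega)]
        simp
  rw [← key, h, map_zero, map_zero]

lemma Pk_of_smul {p : SpecR 𝒜} {C W : T} {n : ℤ} (f : C ⟶ W⟦n⟧) (t : R) (ht : t ∉ p.1.toIdeal)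
    (h : t • mι A n f = 0) : Pk A p f := by
  classical
  by_contra hf
  apply ht
  rw [← DirectSum.sum_support_decompose 𝒜 t]
  refine sum_mem fun k _ => ?_
  by_contra hk
  exact hf ⟨k, _, (DirectSum.decompose 𝒜 t k).2, hk, (smul_mι_zero _ f).1 (comp_smul_zero f t h k)⟩

lemma act_shift_self {i : ℤ} {a : R} (ha : a ∈ 𝒜 i) (X : T) :
    A.act i a ha (X⟦i⟧) = ((-1 : ℤ) ^ (i * i).natAbs) • (A.act i a ha X)⟦i⟧' := by
  rw [A.act_shift]
  congr 1
  simp [shiftComm]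

lemma koszul_tors {r : SpecR 𝒜} {i : ℤ} {x : R} (hx : x ∈ 𝒜 i) (hxr : x ∉ r.1.toIdeal) {D K : T}
    (w : D⟦i⟧ ⟶ K) (d : K ⟶ D⟦(1 : ℤ)⟧) (hTr : Triangle.mk (A.act i x hx D) w d ∈ distTriang T)
    {C : T} (f : C ⟶ K) : Pk A r f := by
  have h0 : d ≫ (A.act i x hx D)⟦(1 : ℤ)⟧' = 0 := comp_distTriang_mor_zero₃₁ _ hTr
  have h0' : A.act i x hx D ≫ w = 0 := comp_distTriang_mor_zero₁₂ _ hTr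
  have h1 : (f ≫ A.act i x hx K) ≫ d⟦i⟧' = 0 := by
    rw [Category.assoc, ← A.act_natural, A.act_shift, Preadditive.comp_zsmul,
      reassoc_of% h0]
    simp
  obtain ⟨l, hl⟩ : ∃ l : C ⟶ (D⟦i⟧)⟦i⟧, f ≫ A.act i x hx K = l ≫ w⟦i⟧' :=
    coyoneda_exact₃_shift _ hTr i _ h1
  refine Pk.of_act (ht := hx) hxr ⟨i, x, hx, hxr, ?_⟩
  rw [hl, Category.assoc, A.act_natural, act_shift_self hx (D⟦i⟧), Preadditive.zsmul_comp,
    ← Functor.map_comp, act_shift_self hx D, Preadditive.zsmul_comp, ← Functor.map_comp, h0']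
  simp

lemma koszul_div {i j : ℤ} {x s : R} (hx : x ∈ 𝒜 i) (hs : s ∈ 𝒜 j) {D K : T}
    (w : D⟦i⟧ ⟶ K) (d : K ⟶ D⟦(1 : ℤ)⟧) (hTr : Triangle.mk (A.act i x hx D) w d ∈ distTriang T)
    (h : w ≫ A.act j s hs K = 0) : ∃ l : D⟦i⟧ ⟶ D⟦j⟧, A.act j s hs D = A.act i x hx D ≫ l := by
  rw [A.act_natural] at h
  obtain ⟨l, hl⟩ : ∃ l : D⟦i⟧ ⟶ D⟦j⟧, A.act j s hs (D⟦i⟧) = l ≫ (A.act i x hx D)⟦j⟧' :=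
    coyoneda_exact₂_shift _ hTr j _ h
  have e1 := A.act_shift j s hs D i
  have e2 := A.act_shift i x hx D j
  have e3 := A.act_natural i x hx l
  have e4 := act_shift_self (A := A) hx D
  have hsq : ∀ k : ℕ, ((-1 : ℤ) ^ k) * ((-1 : ℤ) ^ k) = 1 := fun k => by
    rw [← mul_pow]; simp
  have e2' : (A.act i x hx D)⟦j⟧' =
      ((-1 : ℤ) ^ (i * j).natAbs) • (A.act i x hx (D⟦j⟧) ≫ (shiftComm D i j).inv) := by
    rw [e2, Preadditive.zsmul_comp, smul_smul, hsq, one_smul]; simp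
  have e1' : (A.act j s hs D)⟦i⟧' =
      ((-1 : ℤ) ^ (j * i).natAbs) • (A.act j s hs (D⟦i⟧) ≫ (shiftComm D j i).inv) := by
    rw [e1, Preadditive.zsmul_comp, smul_smul, hsq, one_smul]; simp
  have e5 : (shiftComm D i j).inv ≫ (shiftComm D j i).inv = 𝟙 _ := by
    rw [← shiftComm_symm D i j]; exact (shiftComm D i j).inv_hom_id
  refine ⟨((-1 : ℤ) ^ (i * i).natAbs) • l, ?_⟩
  apply (shiftFunctor T i).map_injective
  rw [e1', hl, e2', Preadditive.comp_zsmul, Preadditive.zsmul_comp, smul_smul]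
  rw [mul_comm i j, hsq, one_smul, Category.assoc, Category.assoc, e5, Category.comp_id, e3, e4]
  simp [Functor.map_comp, Functor.map_zsmul]

lemma koszul_smul {i j : ℤ} {x s : R} (hx : x ∈ 𝒜 i) (hs' : s ∈ 𝒜 j) {D : T}
    (l : D⟦i⟧ ⟶ D⟦j⟧) (hl : A.act j s hs' D = A.act i x hx D ≫ l) (m : MM A D D) :
    ∃ y : MM A D D, s • m = x • y := by
  induction m using MM_ind with
  | h0 => exact ⟨0, by simp⟩
  | h2 a b ha hb =>
    obtain ⟨a', ha⟩ := ha
    obtain ⟨b', hb⟩ := hb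
    exact ⟨a' + b', by rw [smul_add, smul_add, ha, hb]⟩
  | h1 n g =>
    obtain ⟨y, hy⟩ := (shiftFunctor T i).map_surjective (X := D) (Y := D⟦n + j - i⟧)
      (l ≫ g⟦j⟧' ≫ (shiftFunctorAdd' T n j (n + j) rfl).inv.app D ≫
        (shiftFunctorAdd' T (n + j - i) i (n + j) (by omega)).hom.app D)
    refine ⟨mι A _ y, ?_⟩
    rw [smul_mι hx (by omega : n + j - i + i = n + j), smul_mι hs' rfl]
    congr 1
    simp only [hs]
    rw [← Category.assoc, A.act_natural, ← Category.assoc y, A.act_natural, hy, hl]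
    simp

lemma nakayama [Fact (IsGradedComm 𝒜)] [Fact (IsNoetherianRing R)] (hT : NoetherianT A)
    {p : SpecR 𝒜} {D : T} (hD : IsCompactObj T D) {x : evenSub 𝒜} (hx : x ∈ p0 p) {s : R} {j : ℤ}
    (hsj : s ∈ 𝒜 j) (hsp : s ∉ p.1.toIdeal)
    (h : ∀ m : MM A D D, ∃ y : MM A D D, s • m = x.1 • y) : Pk A p (𝟙 D) := by
  have := fin_MM_even hT hD hD
  have hss : s * s ∈ 𝒜 (j + j) := SetLike.mul_mem_graded hsj hsj
  have hev : Even (j + j) := ⟨j, rfl⟩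
  have hssp : s * s ∉ p.1.toIdeal := spec_mul hsj hsj hsp hsp
  let σ : evenSub 𝒜 := ⟨s * s, mem_evenSub_of_even hss hev⟩
  let f : Module.End (evenSub 𝒜) (MM A D D) := LinearMap.lsmul (evenSub 𝒜) (MM A D D) σ
  have hr : LinearMap.range f ≤ Ideal.span {x} • (⊤ : Submodule (evenSub 𝒜) (MM A D D)) := by
    rintro _ ⟨m, rfl⟩
    obtain ⟨y, hy⟩ := h m
    obtain ⟨z, hz⟩ := h y
    have h1 : f m = x • (s • y) := by
      show (s * s) • m = x.1 • (s • y)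
      rw [mul_smul, hy, ← mul_smul, ← mul_smul, even_central 𝒜 Fact.out x.2]
    rw [h1]
    exact Submodule.smul_mem_smul (Ideal.mem_span_singleton_self x) trivial
  obtain ⟨P, hP, -, hc, h0⟩ :=
    LinearMap.exists_monic_and_natDegree_eq_and_coeff_mem_pow_and_aeval_eq_zero (evenSub 𝒜) f _ hr
  have h1 : ∀ m : MM A D D, (P.eval σ) • m = 0 := by
    intro m
    have h2 : Polynomial.aeval f P = algebraMap (evenSub 𝒜) (Module.End (evenSub 𝒜) (MM A D D)) (P.eval σ) := by
      have : f = algebraMap (evenSub 𝒜) (Module.End (evenSub 𝒜) (MM A D D)) σ := rfl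
      rw [this, Polynomial.aeval_algebraMap_apply]
      simp
    have h3 := DFunLike.congr_fun h0 m
    rw [h2] at h3
    exact h3
  have h4 : P.eval σ ∉ p0 p := by
    intro h5
    have h6 : P.eval σ = σ ^ P.natDegree + ∑ k ∈ Finset.range P.natDegree, P.coeff k * σ ^ k := by
      conv_lhs => rw [hP.as_sum]
      simp [Polynomial.eval_finset_sum]
    have h7 : ∑ k ∈ Finset.range P.natDegree, P.coeff k * σ ^ k ∈ p0 p := by
      refine sum_mem fun k hk => Ideal.mul_mem_right _ _ ?_
      have := hc k
      have h8 : Ideal.span {x} ^ (P.natDegree - k) ≤ p0 p :=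
        (Ideal.pow_le_self (by have := Finset.mem_range.1 hk; omega)).trans
          ((Ideal.span_singleton_le_iff_mem _).2 hx)
      exact h8 this
    rw [h6] at h5
    have h9 := (Ideal.add_mem_iff_left _ h7).1 h5
    rw [mem_p0] at h9
    refine pow_notMem p hss hssp P.natDegree ?_
    simpa [σ] using h9
  have h10 : Pk A p ((shiftFunctorZero T ℤ).inv.app D : D ⟶ D⟦(0 : ℤ)⟧) :=
    Pk_of_smul (n := 0) _ (P.eval σ).1 (fun h => h4 ((mem_p0 p _).2 h)) (h1 _)
  have := h10.post ((shiftFunctorZero T ℤ).hom.app D)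
  simpa using this

lemma koszul_step [Fact (IsGradedComm 𝒜)] [Fact (IsNoetherianRing R)] (hT : NoetherianT A)
    {p : SpecR 𝒜} {D : T} (hD : IsCompactObj T D) (hDp : ¬ Pk A p (𝟙 D)) {x : evenSub 𝒜}
    (hx : x ∈ p0 p) {i : ℤ} (hxi : x.1 ∈ 𝒜 i) :
    ∃ K : T, IsCompactObj T K ∧ ¬ Pk A p (𝟙 K) ∧
      (∀ r : SpecR 𝒜, x.1 ∉ r.1.toIdeal ∨ Pk A r (𝟙 D) → Pk A r (𝟙 K)) := by
  obtain ⟨K, w, d, hTr⟩ := distinguished_cocone_triangle (A.act i x.1 hxi D)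
  have hK : IsCompactObj T K := compact_cone _ hTr hD (compact_shift hD i)
  refine ⟨K, hK, ?_, ?_⟩
  · intro h
    have h1 := h.pre w
    rw [Category.comp_id] at h1
    obtain ⟨j, s, hs', hsp, h2⟩ := h1
    obtain ⟨l, hl⟩ := koszul_div hxi hs' w d hTr h2
    exact hDp (nakayama hT hD hx hs' hsp (koszul_smul hxi hs' l hl))
  · rintro r (h | h)
    · exact koszul_tors hxi h w d hTr _
    · have h1 : D ∈ TVset T A {q | q ≠ r} := by
        rw [mem_TV_iff]
        intro C hC q hq f
        have : q = r := by simpa using hq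
        subst this
        simpa using h.pre f
      have h2 : K ∈ TVset T A {q | q ≠ r} := (TV_loc _).ext_mem _ hTr h1 ((TV_loc _).shift_mem _ h1 i)
      rw [mem_TV_iff] at h2
      exact h2 K hK r (by simp) _

lemma exists_koszul [Fact (IsGradedComm 𝒜)] [Fact (IsNoetherianRing R)] (hT : NoetherianT A)
    (p : SpecR 𝒜) {C : T} (hC : IsCompactObj T C) (hCp : ¬ Pk A p (𝟙 C)) :
    ∃ D : T, IsCompactObj T D ∧ D ∉ TVset T A (Zset p) ∧ D ∈ TVset T A (Vp p) := by
  classical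
  obtain ⟨F, hF, hF'⟩ := exists_gens (𝒜 := 𝒜) p
  have key : ∀ G : Finset (evenSub 𝒜), G ⊆ F → ∃ D : T, IsCompactObj T D ∧ ¬ Pk A p (𝟙 D) ∧
      ∀ r : SpecR 𝒜, (∃ x ∈ G, x.1 ∉ r.1.toIdeal) → Pk A r (𝟙 D) := by
    intro G
    induction G using Finset.induction_on with
    | empty => intro _; exact ⟨C, hC, hCp, by simp⟩
    | insert x G hxG ih =>
      intro hG
      obtain ⟨D, hD, hDp, hDr⟩ := ih ((Finset.subset_insert _ _).trans hG)
      obtain ⟨hxp, i, -, hxi⟩ := hF x (hG (Finset.mem_insert_self _ _))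
      obtain ⟨K, hK, hKp, hKr⟩ := koszul_step hT hD hDp hxp hxi
      refine ⟨K, hK, hKp, ?_⟩
      rintro r ⟨y, hy, hyr⟩
      apply hKr
      rcases Finset.mem_insert.1 hy with rfl | hy
      · exact .inl hyr
      · exact .inr (hDr r ⟨y, hy, hyr⟩)
  obtain ⟨D, hD, hDp, hDr⟩ := key F (Finset.Subset.refl _)
  refine ⟨D, hD, ?_, ?_⟩
  · intro h
    rw [mem_TV_iff] at h
    exact hDp (h D hD p (by simp [Zset]) _)
  · rw [mem_TV_iff]
    intro C' hC' r hr f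
    have : ∃ x ∈ F, x.1 ∉ r.1.toIdeal := by
      by_contra hcon
      push Not at hcon
      exact hr (hF' r hcon)
    simpa using (hDr r this).pre f

/-- either nothing is supported at `p`, or there is a good compact object -/
lemma exists_D [Fact (IsGradedComm 𝒜)] [Fact (IsNoetherianRing R)] (hT : NoetherianT A)
    (hgen : CompactlyGen T) (p : SpecR 𝒜) {X : T} (hX : X ∉ TVset T A (Zset p)) :
    ∃ D : T, IsCompactObj T D ∧ D ∉ TVset T A (Zset p) ∧ D ∈ TVset T A (Vp p) := by
  obtain ⟨C, f, hC, hf⟩ := notMem_TVZ hX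
  exact exists_koszul hT p hC (fun h => hf (by simpa using h.post f))
end Koszul
end BIKP

namespace BIKP
open BIK
section InjObj
variable {R : Type u} [Ring R] {𝒜 : ℤ → AddSubgroup R} [GradedRing 𝒜]
variable {T : Type u'} [Category.{v} T] [HasZeroObject T] [Preadditive T] [HasShift T ℤ]
  [∀ n : ℤ, (CategoryTheory.shiftFunctor T n).Additive] [Pretriangulated T]
  [HasCoproducts.{v} T] {A : CenterAction 𝒜 T}

open Classical in
lemma fs_shift {C : T} (hC : IsCompactObj T C) {J : Type v} (f : J → T) (n : ℤ)
    (g : C ⟶ (∐ f)⟦n⟧) :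
    ∃ s : Finset J, g = ∑ j ∈ s, g ≫ (Sigma.π f j)⟦n⟧' ≫ (Sigma.ι f j)⟦n⟧' := by
  obtain ⟨s, hs⟩ := compact_FS hC _ (g ≫ inv (sigmaComparison (shiftFunctor T n) f))
  refine ⟨s, ?_⟩
  have := congrArg (· ≫ sigmaComparison (shiftFunctor T n) f) hs
  simp only [Category.assoc, IsIso.inv_hom_id, Category.comp_id, Preadditive.sum_comp,
    ι_comp_sigmaComparison] at this
  rw [this]
  refine Finset.sum_congr rfl fun j _ => ?_
  rw [← this]
  congr 1
  rw [← Category.assoc]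
  congr 1
  rw [IsIso.inv_comp_eq]
  exact (sigmaComparison_π (shiftFunctor T n) f j).symm

lemma post_zero (C : T) {W W' : T} (x : MM A C W) : post A C (0 : W ⟶ W') x = 0 := by
  have := post_add (A := A) C (0 : W ⟶ W') 0 x
  rw [add_zero] at this
  simpa using this

open Classical in
lemma MM_π_zero {C : T} {J : Type v} (f : J → T) (m : MM A C (∐ f)) (s : Finset J)
    (hs : m = ∑ j ∈ s, post A C (Sigma.ι f j) (post A C (Sigma.π f j) m)) (j : J) (hj : j ∉ s) :
    post A C (Sigma.π f j) m = 0 := by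
  rw [hs, map_sum]
  refine Finset.sum_eq_zero fun k hk => ?_
  have hkj : k ≠ j := by rintro rfl; exact hj hk
  rw [← post_comp, Sigma.ι_π_of_ne f hkj, post_zero]

open Classical in
lemma MM_sum {C : T} (hC : IsCompactObj T C) {J : Type v} (f : J → T) (m : MM A C (∐ f)) :
    ∃ s : Finset J, m = ∑ j ∈ s, post A C (Sigma.ι f j) (post A C (Sigma.π f j) m) := by
  induction m using MM_ind with
  | h0 => exact ⟨∅, by simp⟩
  | h1 n g =>
    obtain ⟨s, hs⟩ := fs_shift hC f n g
    refine ⟨s, ?_⟩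
    conv_lhs => rw [hs]
    rw [map_sum]
    refine Finset.sum_congr rfl fun j _ => ?_
    rw [post_mι, post_mι, Category.assoc]
  | h2 x y hx hy =>
    obtain ⟨s, hs⟩ := hx
    obtain ⟨t, ht⟩ := hy
    have key : ∀ (m : MM A C (∐ f)) (s t : Finset J), s ⊆ t →
        m = ∑ j ∈ s, post A C (Sigma.ι f j) (post A C (Sigma.π f j) m) →
        m = ∑ j ∈ t, post A C (Sigma.ι f j) (post A C (Sigma.π f j) m) := by
      intro m s t hst hs
      rw [← Finset.sum_subset hst]
      · exact hs
      · intro j _ hj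
        rw [MM_π_zero f m s hs j hj, map_zero]
    refine ⟨s ∪ t, ?_⟩
    simp only [map_add, Finset.sum_add_distrib]
    rw [← key x s _ Finset.subset_union_left hs, ← key y t _ Finset.subset_union_right ht]

lemma baer_ext {S : Type u} [CommRing S] {E : Type u} [AddCommGroup E] [Module S E]
    (hE : Module.Baer S E) {M N : Type*} [AddCommGroup M] [AddCommGroup N] [Module S M] [Module S N]
    (φ : M →ₗ[S] N) (y : M →ₗ[S] E) (h : ∀ m, φ m = 0 → y m = 0) :
    ∃ z : N →ₗ[S] E, ∀ m, z (φ m) = y m := by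
  obtain ⟨z, hz⟩ := hE.extension_property ((LinearMap.ker φ).liftQ φ le_rfl)
    (by
      rw [← LinearMap.ker_eq_bot]
      exact Submodule.ker_liftQ_eq_bot' _ _ rfl)
    ((LinearMap.ker φ).liftQ y (fun m hm => h m hm))
  refine ⟨z, fun m => ?_⟩
  exact DFunLike.congr_fun hz (Submodule.Quotient.mk m)

variable (A) in
/-- postcomposition, as a map over the even part -/
noncomputable def post0 (C : T) {W W' : T} (v : W ⟶ W') : MM A C W →ₗ[evenSub 𝒜] MM A C W' :=
  (post A C v).restrictScalars (evenSub 𝒜)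

lemma post0_apply (C : T) {W W' : T} (v : W ⟶ W') (x : MM A C W) : post0 A C v x = post A C v x := rfl

variable (A) in
open Classical in
/-- the cohomological functor `Hom(Hom*(C,-),E)` -/
noncomputable def HE [Fact (IsGradedComm 𝒜)] {C : T} (hC : IsCompactObj T C) (E : Type u)
    [AddCommGroup E] [Module (evenSub 𝒜) E] (hE : Module.Baer (evenSub 𝒜) E) : CohF.{max u v} T where
  obj W := MM A C W →ₗ[evenSub 𝒜] E
  grp W := inferInstance
  map f := AddMonoidHom.mk' (fun φ => φ.comp (post0 A C f)) (fun a b => LinearMap.add_comp _ _ _)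
  map_id X φ := LinearMap.ext fun x => congrArg φ (post_id C X x)
  map_comp f g φ := LinearMap.ext fun x => congrArg φ (post_comp C f g x)
  map_add f g φ := LinearMap.ext fun x => by
    show φ (post A C (f + g) x) = φ (post A C f x) + φ (post A C g x)
    rw [post_add, map_add]
  exact' Tr hTr y hy := by
    obtain ⟨z, hz⟩ := baer_ext hE (post0 A C Tr.mor₂) y (fun m hm => by
      obtain ⟨x, rfl⟩ := post_exact C Tr hTr m hm
      exact DFunLike.congr_fun hy x)
    exact ⟨z, LinearMap.ext hz⟩
  sigma J f x := by
    have hfin : ∀ m : MM A C (∐ f), (Function.support fun j => x j (post A C (Sigma.π f j) m)).Finite := by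
      intro m
      obtain ⟨s, hs⟩ := MM_sum (A := A) hC f m
      refine s.finite_toSet.subset fun j hj => ?_
      by_contra hjs
      apply hj
      show x j (post A C (Sigma.π f j) m) = 0
      rw [MM_π_zero f m s hs j hjs, map_zero]
    refine ⟨{ toFun := fun m => ∑ᶠ j, x j (post A C (Sigma.π f j) m)
              map_add' := ?_
              map_smul' := ?_ }, ?_⟩
    · intro m m'
      rw [← finsum_add_distrib (hfin m) (hfin m')]
      simp only [map_add]
    · intro a m
      rw [RingHom.id_apply, smul_finsum' a (hfin m)]
      refine finsum_congr fun j => ?_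
      rw [← map_smul]
      exact congrArg (x j) (map_smul (post0 A C (Sigma.π f j)) a m)
    · intro j
      refine LinearMap.ext fun m => ?_
      show ∑ᶠ k, x k (post A C (Sigma.π f k) (post A C (Sigma.ι f j) m)) = x j m
      rw [finsum_eq_single _ j]
      · rw [← post_comp, Sigma.ι_π_eq_id, post_id]
      · intro k hk
        rw [← post_comp, Sigma.ι_π_of_ne f hk.symm, post_zero, map_zero]
  sigma_ext J f z hz := by
    refine LinearMap.ext fun m => ?_
    obtain ⟨s, hs⟩ := MM_sum (A := A) hC f m
    rw [hs, map_sum, LinearMap.zero_apply]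
    refine Finset.sum_eq_zero fun j _ => ?_
    exact DFunLike.congr_fun (hz j) (post A C (Sigma.π f j) m)

lemma small_hom {S : Type u} [CommRing S] {E : Type u} [AddCommGroup E] [Module S E]
    (hsm : ∀ 𝔞 : Ideal S, Small.{v} (S ⧸ 𝔞) → Small.{v} {e : E // ∀ x ∈ 𝔞, x • e = 0})
    (M : Type v) [AddCommGroup M] [Module S M] : Small.{v} (M →ₗ[S] E) := by
  let 𝔞 : Ideal S := RingHom.ker (Module.toAddMonoidEnd S M)
  have h1 : Small.{v} (S ⧸ 𝔞) :=
    small_of_injective (β := AddMonoid.End M)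
      (RingHom.kerLift_injective (Module.toAddMonoidEnd S M))
  have := hsm 𝔞 h1
  refine small_of_injective (β := M → {e : E // ∀ x ∈ 𝔞, x • e = 0})
    (f := fun φ m => ⟨φ m, fun x hx => ?_⟩) ?_
  · have : x • m = 0 := DFunLike.congr_fun (RingHom.mem_ker.1 hx) m
    rw [← map_smul, this, map_zero]
  · intro φ ψ h
    ext m
    exact congrArg Subtype.val (congrFun h m)

lemma smul_of_act {j : ℤ} {s : R} (hsj : s ∈ 𝒜 j) {C D : T} {n : ℤ} (k : C⟦j⟧ ⟶ D⟦n⟧) :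
    ∃ y : MM A C D, mι A n (A.act j s hsj C ≫ k) = s • y := by
  obtain ⟨y, hy⟩ := (shiftFunctor T j).map_surjective (X := C) (Y := D⟦n - j⟧)
      (k ≫ (shiftFunctorAdd' T (n - j) j n (by omega)).hom.app D)
  refine ⟨mι A _ y, ?_⟩
  rw [smul_mι hsj (by omega : n - j + j = n)]
  congr 1
  simp only [hs]
  rw [← Category.assoc y, A.act_natural, hy]
  simp

lemma exists_I [Fact (IsGradedComm 𝒜)] [Fact (IsNoetherianRing R)] (hT : NoetherianT A)
    (hgen : CompactlyGen T) (p : SpecR 𝒜) {C : T} (hC : IsCompactObj T C) :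
    ∃ I : T, (∀ U ∈ TVset T A (Zset p), Orth U I) ∧ I ∈ TVset T A (Vp p) ∧
      ∀ (X : T) (f : C ⟶ X), ¬ Pk A p f → ∃ g : X ⟶ I, g ≠ 0 := by
  obtain ⟨E, iE, mE, hE, hES, hEp, ⟨e0, he0, hpe0⟩, hsm⟩ :=
    exists_injData.{v, u} (S0 p) (p0 p) (S0_disj p)
  obtain ⟨ι, g, hg, hloc⟩ := hgen
  let H := HE A hC E hE
  obtain ⟨I, h, hI⟩ := brown (H := H) (K := ι × ℤ) (fun k => (g k.1)⟦k.2⟧)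
    (fun k => compact_shift (hg k.1) k.2)
    (fun S hS hS' W => by
      have : Loc T (Set.range g) ⊆ S := Loc_le hS (by
        rintro _ ⟨i, rfl⟩
        exact hS' _ fun n => ⟨(i, n), ⟨Iso.refl _⟩⟩)
      rw [hloc] at this
      exact this trivial)
    (fun k => small_hom hsm (MM A C ((g k.1)⟦k.2⟧)))
  refine ⟨I, ?_, ?_, ?_⟩
  · intro U hU
    apply Orth.of_left
    intro m f
    have hU' := (TV_loc _).shift_mem U hU m
    apply (hI _).inj0
    refine LinearMap.ext fun x => ?_
    obtain ⟨φ, hφ⟩ : ∃ φ : MM A C (U⟦m⟧) →ₗ[evenSub 𝒜] E, φ = H.map f h := ⟨_, rfl⟩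
    rw [← hφ]
    show φ x = 0
    induction x using MM_ind with
    | h0 => exact map_zero _
    | h2 x y hx hy => rw [map_add, hx, hy, add_zero]
    | h1 n k =>
      rw [mem_TV_iff'] at hU'
      obtain ⟨i, s, hsi, hsp, hk⟩ := hU' C hC p (by simp [Zset]) n k
      have h1 : s • mι A n k = 0 := (smul_mι_zero hsi k).2 hk
      have hss : s * s ∈ 𝒜 (i + i) := SetLike.mul_mem_graded hsi hsi
      let σ : evenSub 𝒜 := ⟨s * s, mem_evenSub_of_even hss ⟨i, rfl⟩⟩
      have hσ : σ ∈ S0 p := ⟨i + i, ⟨i, rfl⟩, hss, spec_mul hsi hsi hsp hsp⟩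
      apply hES σ hσ
      rw [← map_smul]
      have : σ • mι A n k = 0 := by
        show (s * s) • mι A n k = 0
        rw [mul_smul, h1, smul_zero]
      rw [this, map_zero]
  · rw [mem_TV_iff]
    intro D hD r hr g'
    have hr' : ¬ p.1.toIdeal ≤ r.1.toIdeal := hr
    obtain ⟨a, i, hi, hai, hap, har⟩ := exists_even_notMem p r hr'
    have hfin := fin_MM_even hT hC hD
    obtain ⟨ψ, hψ⟩ : ∃ ψ : MM A C D →ₗ[evenSub 𝒜] E, ψ = H.map g' h := ⟨_, rfl⟩
    obtain ⟨N, hN⟩ : ∃ N : ℕ, ∀ b ∈ p0 p ^ N, ∀ m, ψ (b • m) = 0 := by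
      obtain ⟨F, hF⟩ := hfin.1
      choose N hN using hEp
      refine ⟨F.sup (fun m => N (ψ m)), fun b hb m => ?_⟩
      have hm : m ∈ Submodule.span (evenSub 𝒜) (F : Set (MM A C D)) := by rw [hF]; trivial
      rw [map_smul]
      induction hm using Submodule.span_induction with
      | mem x hx =>
        exact hN (ψ x) b (Ideal.pow_le_pow_right (Finset.le_sup (f := fun m => N (ψ m)) hx) hb)
      | zero => simp
      | add x y _ _ hx hy => rw [map_add, smul_add, hx, hy, add_zero]
      | smul c x _ hx => rw [map_smul, smul_comm, hx, smul_zero]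
    obtain ⟨j, s, hsj, hsr, hs0⟩ : ∃ (j : ℤ) (s : R) (hsj : s ∈ 𝒜 j), s ∉ r.1.toIdeal ∧
        ∀ m, ψ (s • m) = 0 :=
      ⟨_, a.1 ^ N, SetLike.pow_mem_graded N hai, pow_notMem r hai har N,
        fun m => hN (a ^ N) (Ideal.pow_mem_pow hap N) m⟩
    refine ⟨j, s, hsj, hsr, ?_⟩
    let D' := D⟦-j⟧
    let e : D'⟦j⟧ ≅ D := (shiftFunctorCompIsoId T (-j) j (by omega)).app D
    have h1 : A.act j s hsj D' ≫ e.hom ≫ g' = 0 := by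
      apply (hI _).inj0
      rw [← Category.assoc, H.map_comp, ← hψ]
      refine LinearMap.ext fun x => ?_
      show ψ (post A C _ x) = 0
      induction x using MM_ind with
      | h0 => rw [map_zero, map_zero]
      | h2 x y hx hy => rw [map_add, map_add, hx, hy, add_zero]
      | h1 n f =>
        rw [post_mι]
        have h2 : ∃ k : C⟦j⟧ ⟶ D⟦n⟧, f ≫ (A.act j s hsj D' ≫ e.hom)⟦n⟧' = A.act j s hsj C ≫ k := by
          have e1 := A.act_shift j s hsj D' n
          have hsq : ∀ k : ℕ, ((-1 : ℤ) ^ k) * ((-1 : ℤ) ^ k) = 1 := fun k => by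
            rw [← mul_pow]; simp
          have e1' : (A.act j s hsj D')⟦n⟧' =
              ((-1 : ℤ) ^ (j * n).natAbs) • (A.act j s hsj (D'⟦n⟧) ≫ (shiftComm D' j n).inv) := by
            rw [e1, Preadditive.zsmul_comp, smul_smul, hsq, one_smul]; simp
          refine ⟨((-1 : ℤ) ^ (j * n).natAbs) • (f⟦j⟧' ≫ (shiftComm D' j n).inv ≫ e.hom⟦n⟧'), ?_⟩
          rw [Functor.map_comp, e1', Preadditive.zsmul_comp, Preadditive.comp_zsmul,
            Preadditive.comp_zsmul, Category.assoc, ← Category.assoc f, A.act_natural,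
            Category.assoc]
        obtain ⟨k, hk⟩ := h2
        obtain ⟨y, hy⟩ := smul_of_act (A := A) hsj k
        rw [hk, hy, hs0]
    rw [← cancel_epi e.hom, comp_zero, ← Category.assoc, A.act_natural, act_shift_self hsj D',
      Preadditive.zsmul_comp, ← Functor.map_comp, h1]
    simp
  · intro X f hf
    let f0 : C ⟶ X⟦(0 : ℤ)⟧ := f ≫ (shiftFunctorZero T ℤ).inv.app X
    have hf0 : ¬ Pk A p f0 := fun hk => hf (by
      have := hk.post ((shiftFunctorZero T ℤ).hom.app X)
      simpa [f0] using this)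
    obtain ⟨φ, hφ⟩ := baer_ext hE (LinearMap.toSpanSingleton (evenSub 𝒜) _ (mι A 0 f0))
      (LinearMap.toSpanSingleton (evenSub 𝒜) _ e0) (fun a ha => by
        apply hpe0
        by_contra hap
        exact hf0 (Pk_of_smul f0 a.1 hap ha))
    obtain ⟨g', hg'⟩ := (hI X).2 φ
    refine ⟨g', ?_⟩
    rintro rfl
    have h1 : H.map (0 : X ⟶ I) h = φ := hg'
    rw [H.map_zero] at h1
    have h2 := hφ 1
    rw [← h1] at h2
    have h3 : (0 : E) = (1 : evenSub 𝒜) • e0 := h2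
    rw [one_smul] at h3
    exact he0 h3.symm

end InjObj
end BIKP

namespace BIKP
open BIK
section Final
variable {R : Type u} [Ring R] {𝒜 : ℤ → AddSubgroup R} [GradedRing 𝒜]
variable {T : Type u'} [Category.{v} T] [HasZeroObject T] [Preadditive T] [HasShift T ℤ]
  [∀ n : ℤ, (CategoryTheory.shiftFunctor T n).Additive] [Pretriangulated T]
  [HasCoproducts.{v} T] {A : CenterAction 𝒜 T}

lemma Loc_single_le {S : Set T} (hS : IsLocalizing T S) {X : T} (h : X ∈ S) : Loc T {X} ⊆ S :=
  Loc_le hS (by rintro _ rfl; exact h)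

lemma isZero_of_orth {Z : T} (h : Orth Z Z) : IsZero Z :=
  (IsZero.iff_id_eq_zero _).2 (h.zero _)

lemma exists_D' [Fact (IsGradedComm 𝒜)] [Fact (IsNoetherianRing R)] (hT : NoetherianT A)
    (hgen : CompactlyGen T) (B : BIKData A) (hst : Stratified B) (p : SpecR 𝒜) {X : T}
    (hX : ¬ IsZero ((B.ΓP p).obj X)) :
    ∃ D : T, IsCompactObj T D ∧ D ∉ TVset T A (Zset p) ∧ D ∈ TVset T A (Vp p) ∧
      B.ΓPImage p ⊆ Loc T {D} := by
  obtain ⟨D, h1, h2, h3⟩ := exists_D hT hgen p (X := X) fun h => hX (ΓP_zero_of_mem B h)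
  refine ⟨D, h1, h2, h3, ?_⟩
  refine (image_sub_Loc B hst (ΓP_mem_image B p D) (ΓP_ne_zero B h3 h2)).trans ?_
  exact Loc_single_le (Loc_isLoc _) (ΓP_mem_Loc B hst p D)

lemma mem_image_of_inj [Fact (IsGradedComm 𝒜)] [Fact (IsNoetherianRing R)] (hT : NoetherianT A)
    (hgen : CompactlyGen T) (B : BIKData A) (hst : Stratified B) (p : SpecR 𝒜) {X I : T}
    (hX : ¬ IsZero ((B.ΓP p).obj X)) (hI : ∀ U ∈ TVset T A (Zset p), Orth U I)
    (hV : I ∈ TVset T A (Vp p)) : I ∈ B.ΓPImage p := by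
  have hS : IsLocalizing T (B.ΓPImage p) := by
    rcases hst.2 p with h | h
    · exact absurd (h _ (ΓP_mem_image B p X)) hX
    · exact h.1
  refine mem_of_ΓP B hst hS fun q => ?_
  by_cases h0 : IsZero ((B.ΓP q).obj I)
  · exact hS.zero_mem _ h0
  obtain ⟨D, h1, h2, h3, h4⟩ := exists_D' hT hgen B hst q h0
  have hm := ΓP_mem_image B q I
  have hl := ΓP_mem_Loc B hst q I
  by_cases hpq : p.1.toIdeal ≤ q.1.toIdeal
  · by_cases hqp : q.1.toIdeal ≤ p.1.toIdeal
    · have : p = q := Subtype.ext (HomogeneousIdeal.toIdeal_injective (le_antisymm hpq hqp))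
      subst this
      exact hm
    · exfalso
      apply h0
      apply isZero_of_orth
      have a1 : Orth D ((B.ΓP q).obj I) :=
        Loc_single_le (orth_right_loc h1) (hI D (TV_Vp_Zq hqp h3)) hl
      have a2 : Loc T {D} ⊆ _ := Loc_single_le (orth_left_loc {(B.ΓP q).obj I})
        (X := D) (by rintro _ rfl; exact a1)
      exact a2 (h4 hm) _ rfl
  · exfalso
    apply h0
    refine image_zero_of_mem B hm (Loc_single_le (TV_loc _) h3 (h4 hm)) ?_
    exact TV_Vp_Zq hpq (Loc_single_le (TV_loc _) hV hl)

lemma exists_I' [Fact (IsGradedComm 𝒜)] [Fact (IsNoetherianRing R)] (hT : NoetherianT A)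
    (hgen : CompactlyGen T) (B : BIKData A) (hst : Stratified B) (q : SpecR 𝒜) {Y : T}
    (hY : ¬ IsZero ((B.ΓP q).obj Y)) :
    ∃ I : T, (∀ U ∈ TVset T A (Zset q), Orth U I) ∧ B.ΓPImage q ⊆ Loc T {I} := by
  obtain ⟨D, h1, h2, h3, h4⟩ := exists_D' hT hgen B hst q hY
  obtain ⟨C, f, hC, hf⟩ := notMem_TVZ h2
  obtain ⟨I, i1, i2, i3⟩ := exists_I hT hgen q hC
  obtain ⟨g, hg⟩ := i3 D f hf
  refine ⟨I, i1, ?_⟩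
  have hz : I ∉ TVset T A (Zset q) := fun h =>
    hg ((isZero_of_orth (i1 I h)).eq_of_tgt _ _)
  refine (image_sub_Loc B hst (ΓP_mem_image B q I) (ΓP_ne_zero B i2 hz)).trans ?_
  exact Loc_single_le (Loc_isLoc _) (ΓP_mem_Loc B hst q I)

theorem main [Fact (IsGradedComm 𝒜)] [Fact (IsNoetherianRing R)] (hT : NoetherianT A)
    (hgen : CompactlyGen T) (B : BIKData A) (hst : Stratified B) (X Y : T) :
    (∀ Y' ∈ Loc T {Y}, Orth X Y') ↔ specCl (B.suppObj X) ∩ B.suppObj Y = ∅ := by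
  constructor
  · intro h
    rw [Set.eq_empty_iff_forall_notMem]
    rintro p ⟨⟨q, hq, hqp⟩, hp⟩
    have hX : X ∉ TVset T A (Zset p) := fun hX => hq (ΓP_zero_of_mem B (TV_Zp_Zq hqp hX))
    obtain ⟨C, f, hC, hf⟩ := notMem_TVZ hX
    obtain ⟨I, i1, i2, i3⟩ := exists_I hT hgen p hC
    obtain ⟨g, hg⟩ := i3 X f hf
    have hI := mem_image_of_inj hT hgen B hst p hp i1 i2
    have hI2 := image_sub_Loc B hst (ΓP_mem_image B p Y) hp hI
    exact hg ((h I (Loc_single_le (Loc_isLoc _) (ΓP_mem_Loc B hst p Y) hI2)).zero g)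
  · intro h
    refine mem_of_ΓP B hst (orth_left_loc (Loc T {Y})) fun p => ?_
    by_cases hp : IsZero ((B.ΓP p).obj X)
    · exact (orth_left_loc (Loc T {Y})).zero_mem _ hp
    obtain ⟨D, h1, h2, h3, h4⟩ := exists_D' hT hgen B hst p hp
    have hDY : Orth D Y := by
      refine mem_of_ΓP B hst (orth_right_loc h1) fun q => ?_
      by_cases hq : IsZero ((B.ΓP q).obj Y)
      · exact (orth_right_loc h1).zero_mem _ hq
      have hpq : ¬ p.1.toIdeal ≤ q.1.toIdeal := fun hpq => by
        have : q ∈ specCl (B.suppObj X) ∩ B.suppObj Y := ⟨⟨p, hp, hpq⟩, hq⟩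
        rw [h] at this
        exact this
      obtain ⟨I, i1, i2⟩ := exists_I' hT hgen B hst q hq
      exact Loc_single_le (orth_right_loc h1) (i1 D (TV_Vp_Zq hpq h3)) (i2 (ΓP_mem_image B q Y))
    have hDL : ∀ Y' ∈ Loc T {Y}, Orth D Y' := fun Y' hY' =>
      Loc_single_le (orth_right_loc h1) hDY hY'
    exact Loc_single_le (orth_left_loc (Loc T {Y})) hDL (h4 (ΓP_mem_image B p X))
end Final
end BIKP

open BIK in
/-- Theorem (orthogonality): if `T` is noetherian and stratified by `R`, then for objects
`X`, `Y`: `Hom*(X, Y') = 0` for all `Y' ∈ Loc(Y)` iff `cl(supp_R X) ∩ supp_R Y = ∅`. -/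
theorem statement_7
{R : Type u} [Ring R] (𝒜 : ℤ → AddSubgroup R) [GradedRing 𝒜]
    (hcomm : IsGradedComm 𝒜) (hnoeth : IsNoetherianRing R)
    {T : Type u'} [Category.{v} T] [HasZeroObject T] [Preadditive T] [HasShift T ℤ]
    [∀ n : ℤ, (CategoryTheory.shiftFunctor T n).Additive] [Pretriangulated T]
    [HasCoproducts.{v} T]
    (hgen : CompactlyGen T)
    (A : CenterAction 𝒜 T) (B : BIKData A)
    (hT : NoetherianT A) (hst : Stratified B) (X Y : T) :
    (∀ Y' ∈ Loc T {Y}, ∀ (n : ℤ) (f : X ⟶ Y'⟦n⟧), f = 0) ↔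
      specCl (B.suppObj X) ∩ B.suppObj Y = ∅ := by
  haveI : Fact (IsGradedComm 𝒜) := ⟨hcomm⟩
  haveI : Fact (IsNoetherianRing R) := ⟨hnoeth⟩
  exact BIKP.main hT hgen B hst X Y
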